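/- arXiv:2312.01819 — 2 statements merged into one kernel-verified Lean document; each statement's English description precedes it below -/
import Mathlib

section
/- Let α ∈ (0, 3/2 + √2], and assume |h_α(p(·,s))| < ∞ for all s ∈ [0,1] (with p(·,0) = f, i.e. h_α(X) = h_α(f) is finite and t_α > 1). Then for every t ∈ [0,1], exp(h_α(X + √t·Z)) ≥ (1−t)·exp(h_α(X)) + t·exp(h_α(X + Z)), where h_α(X + √t·Z) = h_α(p(·,t)). -/
open MeasureTheory Real Filter
open scoped Classical

/-- The density `p(x,t)` of `X + √t Z` along the heat flow. -/
noncomputable def heatP (f : ℝ → ℝ) (t x : ℝ) : ℝ :=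
  ∫ y : ℝ, f y * ((Real.sqrt (2 * Real.pi * t))⁻¹ * Real.exp (-(x - y) ^ 2 / (2 * t)))

/-- `p_k(x,t) = ∂^k p / ∂x^k`. -/
noncomputable def pk (f : ℝ → ℝ) (k : ℕ) (t x : ℝ) : ℝ :=
  iteratedDeriv k (heatP f t) x

/-- `p̄_i = p_i / p`. -/
noncomputable def pbar (f : ℝ → ℝ) (i : ℕ) (t x : ℝ) : ℝ :=
  pk f i t x / heatP f t x

/-- The Rényi entropy `h_α(p(·,t))`, with the Shannon entropy at `α = 1`. -/
noncomputable def renyiEnt (f : ℝ → ℝ) (α t : ℝ) : ℝ :=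
  if α = 1 then -∫ x : ℝ, heatP f t x * Real.log (heatP f t x)
  else (1 - α)⁻¹ * Real.log (∫ x : ℝ, heatP f t x ^ α)

/-- Finiteness `|h_α(p(·,t))| < ∞` of the Rényi entropy at time `t`. -/
def renyiFinite (f : ℝ → ℝ) (α t : ℝ) : Prop :=
  if α = 1 then Integrable (fun x : ℝ => heatP f t x * Real.log (heatP f t x))
  else Integrable (fun x : ℝ => heatP f t x ^ α) ∧ 0 < ∫ x : ℝ, heatP f t x ^ α

/-- `t < t_α` where `t_α = sup { s > 0 : |h_α(p(·,s))| < ∞ }`. -/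
def ltTalpha (f : ℝ → ℝ) (α t : ℝ) : Prop :=
  ∃ s : ℝ, t < s ∧ 0 < s ∧ renyiFinite f α s

/-- The tilted expectation `E_α[g] = (∫ g p^α) / (∫ p^α)`. -/
noncomputable def Ea (f : ℝ → ℝ) (α t : ℝ) (g : ℝ → ℝ) : ℝ :=
  (∫ x : ℝ, g x * heatP f t x ^ α) / (∫ x : ℝ, heatP f t x ^ α)

/-- The density of `X + √t Z`, extended to `t = 0` by the density of `X`. -/
noncomputable def heatP0 (f : ℝ → ℝ) (t x : ℝ) : ℝ :=
  if t = 0 then f x else heatP f t x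

/-- The Rényi entropy along the (extended) heat flow, Shannon entropy at order 1. -/
noncomputable def renyiEnt0 (f : ℝ → ℝ) (α t : ℝ) : ℝ :=
  if α = 1 then -∫ x : ℝ, heatP0 f t x * Real.log (heatP0 f t x)
  else (1 - α)⁻¹ * Real.log (∫ x : ℝ, heatP0 f t x ^ α)

/-- Finiteness of the Rényi entropy along the (extended) heat flow. -/
def renyiFinite0 (f : ℝ → ℝ) (α t : ℝ) : Prop :=
  if α = 1 then Integrable (fun x : ℝ => heatP0 f t x * Real.log (heatP0 f t x))
  else Integrable (fun x : ℝ => heatP0 f t x ^ α) ∧ 0 < ∫ x : ℝ, heatP0 f t x ^ α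


/-! ### Kernel -/

lemma hd_congr {f g : ℝ → ℝ} {d d' x : ℝ} (h : HasDerivAt g d' x) (h1 : ∀ y, f y = g y)
    (h2 : d = d') : HasDerivAt f d x := by
  have : f = g := funext h1
  rw [this, h2]; exact h

noncomputable def KK (s z : ℝ) : ℝ := (Real.sqrt (2 * Real.pi * s))⁻¹ * Real.exp (-z ^ 2 / (2 * s))

noncomputable def HH (k : ℕ) (s z : ℝ) : ℝ :=
  match k with
  | 0 => 1
  | 1 => -(z / s)
  | 2 => z ^ 2 / s ^ 2 - 1 / s
  | 3 => -(z ^ 3 / s ^ 3) + 3 * z / s ^ 2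
  | 4 => z ^ 4 / s ^ 4 - 6 * z ^ 2 / s ^ 3 + 3 / s ^ 2
  | _ => 0

noncomputable def PP (f : ℝ → ℝ) (k : ℕ) (s x : ℝ) : ℝ :=
  ∫ y : ℝ, f y * (HH k s (x - y) * KK s (x - y))

lemma KK_pos {s : ℝ} (hs : 0 < s) (z : ℝ) : 0 < KK s z := by
  unfold KK; positivity

lemma KK_cont (s : ℝ) : Continuous (KK s) := by
  unfold KK; fun_prop

lemma HH_cont (k : ℕ) (s : ℝ) : Continuous (HH k s) := by
  unfold HH
  split <;> fun_prop

lemma KK_ratio {s T : ℝ} (hs : 0 < s) (hT : 0 < T) (z : ℝ) :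
    KK s z = Real.sqrt (T / s) * Real.exp (-(1 / (2 * s) - 1 / (2 * T)) * z ^ 2) * KK T z := by
  unfold KK
  have h1 : Real.sqrt (2 * Real.pi * s) = Real.sqrt (2 * Real.pi) * Real.sqrt s :=
    Real.sqrt_mul (by positivity) _
  have h2 : Real.sqrt (2 * Real.pi * T) = Real.sqrt (2 * Real.pi) * Real.sqrt T :=
    Real.sqrt_mul (by positivity) _
  have h3 : Real.exp (-z ^ 2 / (2 * s)) =
      Real.exp (-(1 / (2 * s) - 1 / (2 * T)) * z ^ 2) * Real.exp (-z ^ 2 / (2 * T)) := by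
    rw [← Real.exp_add]; congr 1; field_simp; ring
  have h4 : 0 < Real.sqrt (2 * Real.pi) := by positivity
  have h5 : 0 < Real.sqrt s := by positivity
  have h6 : 0 < Real.sqrt T := by positivity
  rw [h1, h2, h3, Real.sqrt_div hT.le]
  field_simp

lemma KK_le {s T : ℝ} (hs : 0 < s) (hT : s ≤ T) (z : ℝ) :
    KK s z ≤ Real.sqrt (T / s) * KK T z := by
  have hT0 : 0 < T := hs.trans_le hT
  rw [KK_ratio hs hT0 z]
  have : Real.exp (-(1 / (2 * s) - 1 / (2 * T)) * z ^ 2) ≤ 1 := by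
    rw [Real.exp_le_one_iff]
    have : 1 / (2 * T) ≤ 1 / (2 * s) := by gcongr
    nlinarith [sq_nonneg z]
  have := KK_pos hT0 z
  have h7 : Real.sqrt (T / s) * Real.exp (-(1 / (2 * s) - 1 / (2 * T)) * z ^ 2) ≤
    Real.sqrt (T / s) * 1 := by gcongr
  rw [mul_one] at h7
  gcongr

lemma KK_bdd {T : ℝ} (z : ℝ) (hT : 0 < T) : KK T z ≤ (Real.sqrt (2 * Real.pi * T))⁻¹ := by
  unfold KK
  have : Real.exp (-z ^ 2 / (2 * T)) ≤ 1 := by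
    rw [Real.exp_le_one_iff]
    apply div_nonpos_of_nonpos_of_nonneg <;> nlinarith [sq_nonneg z]
  exact mul_le_of_le_one_right (by positivity) this

lemma KK_poly (N : ℕ) {a b T : ℝ} (ha : 0 < a) (hab : a ≤ b) (hb : b < T) :
    ∃ C : ℝ, 0 < C ∧ ∀ s ∈ Set.Icc a b, ∀ z : ℝ, (1 + z ^ 2) ^ N * KK s z ≤ C * KK T z := by
  have hb0 : 0 < b := ha.trans_le hab
  have hT : 0 < T := hb0.trans hb
  set c : ℝ := 1 / (2 * b) - 1 / (2 * T) with hc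
  have hc0 : 0 < c := by
    have : 1 / (2 * T) < 1 / (2 * b) := by gcongr
    linarith
  refine ⟨Real.sqrt (T / a) * (N.factorial * Real.exp c / c ^ N), by positivity, ?_⟩
  rintro s ⟨has, hsb⟩ z
  have hs0 : 0 < s := ha.trans_le has
  rw [KK_ratio hs0 hT z]
  have h1 : Real.sqrt (T / s) ≤ Real.sqrt (T / a) := by
    apply Real.sqrt_le_sqrt; gcongr
  have h2 : Real.exp (-(1 / (2 * s) - 1 / (2 * T)) * z ^ 2) ≤ Real.exp (-c * z ^ 2) := by
    apply Real.exp_le_exp.2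
    have : 1 / (2 * b) ≤ 1 / (2 * s) := by gcongr
    nlinarith [sq_nonneg z]
  have h3 : (1 + z ^ 2) ^ N * Real.exp (-c * z ^ 2) ≤ N.factorial * Real.exp c / c ^ N := by
    have h := Real.pow_div_factorial_le_exp (c * (1 + z ^ 2)) (by positivity) N
    have e : Real.exp (c * (1 + z ^ 2)) = Real.exp c * Real.exp (c * z ^ 2) := by
      rw [← Real.exp_add]; congr 1; ring
    have e2 : Real.exp (-c * z ^ 2) * Real.exp (c * z ^ 2) = 1 := by
      rw [← Real.exp_add]; simp
    rw [div_le_iff₀ (by positivity), mul_pow, e] at h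
    rw [le_div_iff₀ (by positivity)]
    have hp := Real.exp_pos (-c * z ^ 2)
    calc (1 + z ^ 2) ^ N * Real.exp (-c * z ^ 2) * c ^ N
        = (c ^ N * (1 + z ^ 2) ^ N) * Real.exp (-c * z ^ 2) := by ring
      _ ≤ (Real.exp c * Real.exp (c * z ^ 2) * N.factorial) * Real.exp (-c * z ^ 2) := by gcongr
      _ = N.factorial * Real.exp c * (Real.exp (-c * z ^ 2) * Real.exp (c * z ^ 2)) := by ring
      _ = _ := by rw [e2, mul_one]
  have hk := KK_pos hT z
  calc (1 + z ^ 2) ^ N * (Real.sqrt (T / s) * Real.exp (-(1 / (2 * s) - 1 / (2 * T)) * z ^ 2) * KK T z)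
      ≤ (1 + z ^ 2) ^ N * (Real.sqrt (T / a) * Real.exp (-c * z ^ 2) * KK T z) := by gcongr
    _ = Real.sqrt (T / a) * ((1 + z ^ 2) ^ N * Real.exp (-c * z ^ 2)) * KK T z := by ring
    _ ≤ _ := by gcongr

lemma HH_bound {a : ℝ} (ha : 0 < a) :
    ∃ C : ℝ, 1 ≤ C ∧ ∀ k : ℕ, ∀ s, a ≤ s → ∀ z : ℝ, |HH k s z| ≤ C * (1 + z ^ 2) ^ 2 := by
  set u : ℝ := 1 + 1 / a with hu
  have hu1 : 1 ≤ u := by rw [hu]; have : 0 < 1 / a := by positivity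
                         linarith
  refine ⟨10 * u ^ 4, by nlinarith [one_le_pow₀ hu1 (n := 4)], ?_⟩
  intro k s hs z
  have hs0 : 0 < s := ha.trans_le hs
  set i : ℝ := 1 / s with hi
  have hi0 : 0 < i := by positivity
  have hiu : i ≤ u := by
    have : 1 / s ≤ 1 / a := by gcongr
    linarith
  have q0 : (1:ℝ) ≤ u ^ 4 := one_le_pow₀ hu1
  have q1 : i ≤ u ^ 4 := hiu.trans (le_self_pow₀ hu1 (by norm_num))
  have q2 : i ^ 2 ≤ u ^ 4 := (pow_le_pow_left₀ hi0.le hiu 2).trans (pow_le_pow_right₀ hu1 (by norm_num))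
  have q3 : i ^ 3 ≤ u ^ 4 := (pow_le_pow_left₀ hi0.le hiu 3).trans (pow_le_pow_right₀ hu1 (by norm_num))
  have q4 : i ^ 4 ≤ u ^ 4 := (pow_le_pow_left₀ hi0.le hiu 4)
  set U := u ^ 4
  set B := (1 + z ^ 2) ^ 2 with hB
  have b0 : 1 ≤ B := by rw [hB]; nlinarith [sq_nonneg z]
  have b1 : |z| ≤ B := by
    rw [hB, ← sq_abs z]; nlinarith [sq_nonneg (|z| - 1), abs_nonneg z, sq_nonneg (|z|^2)]
  have b2 : |z| ^ 2 ≤ B := by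
    rw [hB, ← sq_abs z]; nlinarith [sq_nonneg (|z| - 1), abs_nonneg z, sq_nonneg (|z|^2)]
  have b3 : |z| ^ 3 ≤ B := by
    rw [hB, ← sq_abs z]; nlinarith [sq_nonneg (|z|^2 - |z|), abs_nonneg z, sq_nonneg (|z|^2)]
  have b4 : |z| ^ 4 ≤ B := by
    rw [hB, ← sq_abs z]; nlinarith [sq_nonneg (|z| - 1), abs_nonneg z, sq_nonneg (|z|^2)]
  have ab : ∀ x y c d : ℝ, 0 ≤ x → 0 ≤ y → x ≤ c → y ≤ d → x * y ≤ c * d := by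
    intro x y c d hx hy h1 h2; exact mul_le_mul h1 h2 hy (hx.trans h1)
  have hz := abs_nonneg z
  have UB : 0 ≤ U * B := by nlinarith
  unfold HH
  split
  · rw [abs_one]; nlinarith [ab 1 1 U B (by norm_num) (by norm_num) q0 b0]
  · rw [show -(z / s) = -(i * z) by rw [hi]; ring, abs_neg, abs_mul, abs_of_pos hi0]
    nlinarith [ab i |z| U B (by positivity) (by positivity) q1 b1]
  · rw [show z ^ 2 / s ^ 2 - 1 / s = i ^ 2 * z ^ 2 - i * 1 by rw [hi]; ring]
    refine (abs_sub _ _).trans ?_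
    rw [abs_mul, abs_mul, abs_pow, abs_pow, abs_of_pos hi0, abs_one]
    nlinarith [ab (i^2) (|z|^2) U B (by positivity) (by positivity) q2 b2,
      ab i 1 U B (by positivity) (by positivity) q1 b0]
  · rw [show -(z ^ 3 / s ^ 3) + 3 * z / s ^ 2 = 3 * (i ^ 2 * z) - i ^ 3 * z ^ 3 by rw [hi]; ring]
    refine (abs_sub _ _).trans ?_
    rw [abs_mul, abs_mul, abs_mul, abs_pow, abs_pow, abs_pow, abs_of_pos hi0, abs_of_pos (by norm_num : (0:ℝ) < 3)]
    nlinarith [ab (i^2) (|z|) U B (by positivity) (by positivity) q2 b1,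
      ab (i^3) (|z|^3) U B (by positivity) (by positivity) q3 b3]
  · rw [show z ^ 4 / s ^ 4 - 6 * z ^ 2 / s ^ 3 + 3 / s ^ 2 =
      (i ^ 4 * z ^ 4 - 6 * (i ^ 3 * z ^ 2)) + 3 * (i ^ 2 * 1) by rw [hi]; ring]
    refine (abs_add_le _ _).trans ((add_le_add_left (abs_sub _ _) _).trans ?_)
    rw [abs_mul, abs_mul, abs_mul, abs_mul, abs_mul, abs_pow, abs_pow, abs_pow, abs_pow, abs_pow, abs_of_pos hi0,
      abs_of_pos (by norm_num : (0:ℝ) < 3), abs_of_pos (by norm_num : (0:ℝ) < 6), abs_one]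
    nlinarith [ab (i^4) (|z|^4) U B (by positivity) (by positivity) q4 b4,
      ab (i^3) (|z|^2) U B (by positivity) (by positivity) q3 b2,
      ab (i^2) 1 U B (by positivity) (by positivity) q2 b0]
  · simp; nlinarith

lemma KK_deriv_z {s : ℝ} (hs : 0 < s) (z : ℝ) : HasDerivAt (KK s) (-(z / s) * KK s z) z := by
  unfold KK
  have h : HasDerivAt (fun z : ℝ => -z ^ 2 / (2 * s)) (-(2 * z) / (2 * s)) z := by
    have := ((hasDerivAt_pow 2 z).neg).div_const (2 * s)
    simpa using this
  refine hd_congr (h.exp.const_mul ((Real.sqrt (2 * Real.pi * s))⁻¹)) (fun _ => rfl) ?_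
  field_simp

lemma KK_deriv_s {s : ℝ} (hs : 0 < s) (z : ℝ) :
    HasDerivAt (fun s => KK s z) ((z ^ 2 / s ^ 2 - 1 / s) / 2 * KK s z) s := by
  unfold KK
  have h : HasDerivAt (fun s : ℝ => -z ^ 2 / (2 * s)) (z ^ 2 / (2 * s ^ 2)) s := by
    have := ((hasDerivAt_id s).inv hs.ne').const_mul (-z ^ 2 / 2)
    refine hd_congr this (fun s => ?_) ?_
    · simp; ring
    · simp; field_simp
  have h2 : HasDerivAt (fun s : ℝ => (Real.sqrt (2 * Real.pi * s))⁻¹)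
      (-(1 / (2 * s)) * (Real.sqrt (2 * Real.pi * s))⁻¹) s := by
    have h3 : HasDerivAt (fun s : ℝ => 2 * Real.pi * s) (2 * Real.pi) s := by
      simpa using (hasDerivAt_id s).const_mul (2 * Real.pi)
    have hp : 0 < 2 * Real.pi * s := by positivity
    have hq : 0 < Real.sqrt (2 * Real.pi * s) := by positivity
    refine hd_congr ((h3.sqrt hp.ne').inv hq.ne') (fun _ => rfl) ?_
    have e := Real.sq_sqrt hp.le
    rw [e]
    field_simp
  refine hd_congr (h2.mul h.exp) (fun _ => rfl) ?_
  field_simp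
  ring

lemma HHKK_deriv_z {k : ℕ} (hk : k ≤ 3) {s : ℝ} (hs : 0 < s) (z : ℝ) :
    HasDerivAt (fun z => HH k s z * KK s z) (HH (k + 1) s z * KK s z) z := by
  have hid := hasDerivAt_id z
  have hp : ∀ n : ℕ, HasDerivAt (fun z : ℝ => z ^ n) (n * z ^ (n - 1)) z := fun n => hasDerivAt_pow n z
  have main : ∀ d, HasDerivAt (HH k s) d z → d - (z / s) * HH k s z = HH (k + 1) s z →
      HasDerivAt (fun z => HH k s z * KK s z) (HH (k + 1) s z * KK s z) z := by
    intro d hd he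
    refine hd_congr (hd.mul (KK_deriv_z hs z)) (fun _ => rfl) ?_
    rw [← he]; ring
  interval_cases k
  · refine main 0 (hasDerivAt_const _ _) ?_
    simp [HH]
  · refine main (-(1 / s)) ?_ ?_
    · exact (hid.div_const s).neg
    · simp only [HH]; field_simp; ring
  · refine main (2 * z / s ^ 2 - 0) ?_ ?_
    · refine hd_congr (((hp 2).div_const (s ^ 2)).sub (hasDerivAt_const z (1 / s))) (fun _ => rfl) ?_
      simp
    · simp only [HH]; field_simp; ring
  · refine main (-(3 * z ^ 2 / s ^ 3) + 3 / s ^ 2) ?_ ?_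
    · refine hd_congr (((hp 3).div_const (s ^ 3)).neg.add ((hid.const_mul 3).div_const (s ^ 2))) (fun _ => rfl) ?_
      simp
    · simp only [HH]; field_simp; ring

lemma HHKK_deriv_s {k : ℕ} (hk : k = 0 ∨ k = 2) {s : ℝ} (hs : 0 < s) (z : ℝ) :
    HasDerivAt (fun s => HH k s z * KK s z) (HH (k + 2) s z / 2 * KK s z) s := by
  rcases hk with rfl | rfl
  · simpa [HH] using KK_deriv_s hs z
  · have hi := (hasDerivAt_id s).inv hs.ne'
    have h1 : HasDerivAt (fun s : ℝ => z ^ 2 / s ^ 2 - 1 / s) (-2 * z ^ 2 / s ^ 3 + 1 / s ^ 2) s := by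
      refine hd_congr (((hi.pow 2).const_mul (z ^ 2)).sub hi) (fun s => ?_) ?_
      · simp; ring
      · simp; field_simp; ring
    refine hd_congr (h1.mul (KK_deriv_s hs z)) (fun _ => rfl) ?_
    simp only [HH]
    field_simp
    ring

/-! ### The heat flow -/

lemma heatP_eq (f : ℝ → ℝ) (s x : ℝ) : heatP f s x = PP f 0 s x := by
  simp [heatP, PP, HH, KK]

lemma heatP_eq' (f : ℝ → ℝ) (s x : ℝ) : heatP f s x = ∫ y, f y * KK s (x - y) := rfl

lemma int_bdd {f : ℝ → ℝ} (hfi : Integrable f) {g : ℝ → ℝ} (hg : Continuous g) {C : ℝ}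
    (hC : ∀ z, |g z| ≤ C) (x : ℝ) : Integrable (fun y => f y * g (x - y)) := by
  refine hfi.mul_bdd (c := C) ?_ (Eventually.of_forall fun y => ?_)
  · exact (hg.comp (continuous_const.sub continuous_id)).aestronglyMeasurable
  · exact hC _

lemma HHKK_cont (k : ℕ) (s : ℝ) : Continuous (fun z => HH k s z * KK s z) :=
  (HH_cont k s).mul (KK_cont s)

lemma HHKK_bdd {a b : ℝ} (ha : 0 < a) (hab : a ≤ b) :
    ∃ C : ℝ, 0 ≤ C ∧ ∀ k : ℕ, ∀ s ∈ Set.Icc a b, ∀ z : ℝ, |HH k s z * KK s z| ≤ C := by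
  obtain ⟨C1, hC1, h1⟩ := HH_bound ha
  obtain ⟨C2, hC2, h2⟩ := KK_poly 2 ha hab (lt_add_one b)
  have hb1 : 0 < b + 1 := by linarith
  refine ⟨C1 * (C2 * (Real.sqrt (2 * Real.pi * (b + 1)))⁻¹), by positivity, ?_⟩
  intro k s hs z
  have hk := KK_pos (ha.trans_le hs.1) z
  rw [abs_mul, abs_of_pos hk]
  calc |HH k s z| * KK s z ≤ C1 * (1 + z ^ 2) ^ 2 * KK s z := by gcongr; exact h1 k s hs.1 z
    _ = C1 * ((1 + z ^ 2) ^ 2 * KK s z) := by ring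
    _ ≤ C1 * (C2 * KK (b + 1) z) := mul_le_mul_of_nonneg_left (h2 s hs z) (by linarith)
    _ ≤ _ := by gcongr; exact KK_bdd z hb1

lemma PP_int {f : ℝ → ℝ} (hfi : Integrable f) (k : ℕ) {s : ℝ} (hs : 0 < s) (x : ℝ) :
    Integrable (fun y => f y * (HH k s (x - y) * KK s (x - y))) := by
  obtain ⟨C, -, hC⟩ := HHKK_bdd hs le_rfl
  exact int_bdd hfi (HHKK_cont k s) (fun z => hC k s ⟨le_rfl, le_rfl⟩ z) x

lemma PP_dx {f : ℝ → ℝ} (hfi : Integrable f) {k : ℕ} (hk : k ≤ 3) {s : ℝ} (hs : 0 < s) (x : ℝ) :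
    HasDerivAt (PP f k s) (PP f (k + 1) s x) x := by
  obtain ⟨C, hC0, hC⟩ := HHKK_bdd hs le_rfl
  refine (hasDerivAt_integral_of_dominated_loc_of_deriv_le (μ := volume)
    (F := fun x y => f y * (HH k s (x - y) * KK s (x - y)))
    (F' := fun x y => f y * (HH (k + 1) s (x - y) * KK s (x - y)))
    (bound := fun y => |f y| * C) (s := Set.univ) univ_mem ?_ ?_ ?_ ?_ ?_ ?_).2
  · exact Eventually.of_forall fun x => (PP_int hfi k hs x).aestronglyMeasurable
  · exact PP_int hfi k hs x
  · exact (PP_int hfi (k + 1) hs x).aestronglyMeasurable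
  · refine Eventually.of_forall fun y x _ => ?_
    rw [norm_mul, Real.norm_eq_abs, Real.norm_eq_abs]
    gcongr
    exact hC _ s ⟨le_rfl, le_rfl⟩ _
  · exact hfi.abs.mul_const C
  · refine Eventually.of_forall fun y x _ => ?_
    exact ((HHKK_deriv_z hk hs (x - y)).comp_sub_const x y).const_mul (f y)

lemma PP_ds {f : ℝ → ℝ} (hfi : Integrable f) {k : ℕ} (hk : k = 0 ∨ k = 2) {s : ℝ} (hs : 0 < s) (x : ℝ) :
    HasDerivAt (fun s => PP f k s x) (PP f (k + 2) s x / 2) s := by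
  obtain ⟨C, hC0, hC⟩ := HHKK_bdd (a := s / 2) (b := s + 1) (by positivity) (by linarith)
  have e : PP f (k + 2) s x / 2 = ∫ y, f y * (HH (k + 2) s (x - y) / 2 * KK s (x - y)) := by
    unfold PP; rw [← integral_div]; congr 1; ext y; ring
  rw [e]
  have hn : Set.Ioo (s / 2) (s + 1) ∈ nhds s := Ioo_mem_nhds (by linarith) (by linarith)
  have hi : Integrable (fun y => f y * (HH (k + 2) s (x - y) / 2 * KK s (x - y))) := by
    refine ((PP_int hfi (k + 2) hs x).div_const 2).congr (Eventually.of_forall fun y => ?_)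
    simp only; ring
  refine (hasDerivAt_integral_of_dominated_loc_of_deriv_le (μ := volume)
    (F := fun s y => f y * (HH k s (x - y) * KK s (x - y)))
    (F' := fun s y => f y * (HH (k + 2) s (x - y) / 2 * KK s (x - y)))
    (bound := fun y => |f y| * C) hn ?_ ?_ ?_ ?_ ?_ ?_).2
  · filter_upwards [hn] with u hu
    exact (PP_int hfi k (by linarith [hu.1]) x).aestronglyMeasurable
  · exact PP_int hfi k hs x
  · exact hi.aestronglyMeasurable
  · refine Eventually.of_forall fun y u hu => ?_
    rw [norm_mul, Real.norm_eq_abs, Real.norm_eq_abs]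
    gcongr
    have := hC (k + 2) u ⟨hu.1.le, hu.2.le⟩ (x - y)
    rw [show HH (k + 2) u (x - y) / 2 * KK u (x - y) = (HH (k + 2) u (x - y) * KK u (x - y)) / 2 by ring,
      abs_div, abs_two]
    linarith
  · exact hfi.abs.mul_const C
  · refine Eventually.of_forall fun y u hu => ?_
    exact (HHKK_deriv_s hk (by linarith [hu.1]) (x - y)).const_mul (f y)

lemma KKint {f : ℝ → ℝ} (hfi : Integrable f) {s : ℝ} (hs : 0 < s) (x : ℝ) :
    Integrable (fun y => f y * KK s (x - y)) := by
  simpa [HH] using PP_int hfi 0 hs x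

lemma heatP_pos {f : ℝ → ℝ} (hfi : Integrable f) (hf0 : ∀ x, 0 ≤ f x) (hf1 : (∫ x : ℝ, f x) = 1)
    {s : ℝ} (hs : 0 < s) (x : ℝ) : 0 < heatP f s x := by
  rw [heatP_eq']
  rw [integral_pos_iff_support_of_nonneg (fun y => mul_nonneg (hf0 y) (KK_pos hs _).le) (KKint hfi hs x)]
  have h : 0 < ∫ x, f x := by rw [hf1]; norm_num
  rw [integral_pos_iff_support_of_nonneg hf0 hfi] at h
  convert h using 2
  ext y
  simp [(KK_pos hs (x - y)).ne']

lemma heatP_le {f : ℝ → ℝ} (hfi : Integrable f) (hf0 : ∀ x, 0 ≤ f x)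
    {s T : ℝ} (hs : 0 < s) (hsT : s ≤ T) (x : ℝ) : heatP f s x ≤ Real.sqrt (T / s) * heatP f T x := by
  rw [heatP_eq', heatP_eq', ← integral_const_mul]
  refine integral_mono (KKint hfi hs x) ((KKint hfi (hs.trans_le hsT) x).const_mul _) fun y => ?_
  have := KK_le hs hsT (x - y)
  have h0 := hf0 y
  calc f y * KK s (x - y) ≤ f y * (Real.sqrt (T / s) * KK T (x - y)) := by gcongr
    _ = _ := by ring

lemma polyint {f : ℝ → ℝ} (hfi : Integrable f) (N : ℕ) {s : ℝ} (hs : 0 < s) (x : ℝ) :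
    Integrable (fun y => f y * ((1 + (x - y) ^ 2) ^ N * KK s (x - y))) := by
  obtain ⟨C, hC0, hC⟩ := KK_poly N hs le_rfl (lt_add_one s)
  refine int_bdd hfi (g := fun z => (1 + z ^ 2) ^ N * KK s z)
    (C := C * (Real.sqrt (2 * Real.pi * (s + 1)))⁻¹) ?_ (fun z => ?_) x
  · have := KK_cont s
    fun_prop
  · have := KK_pos hs z
    rw [abs_of_nonneg (by positivity)]
    refine (hC s ⟨le_rfl, le_rfl⟩ z).trans ?_
    gcongr
    exact KK_bdd z (by linarith)

/-- Key uniform bound on logarithmic derivatives. -/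
lemma key_bound {f : ℝ → ℝ} (hfi : Integrable f) (hf0 : ∀ x, 0 ≤ f x) (hf1 : (∫ x : ℝ, f x) = 1)
    {α : ℝ} (hα : 0 < α) {a b : ℝ} (ha : 0 < a) (hab : a ≤ b) (hb : b < 1) :
    ∃ C : ℝ, 0 < C ∧ ∀ s ∈ Set.Icc a b, ∀ x, ∃ ρ : ℝ, 1 ≤ ρ ∧
      (∀ k, |PP f k s x / heatP f s x| ≤ ρ) ∧ ρ ^ 4 * heatP f s x ^ α ≤ C * heatP f 1 x ^ α := by
  obtain ⟨C1, hC1, h1⟩ := HH_bound ha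
  obtain ⟨n, hn⟩ := exists_nat_ge (4 / α)
  rw [div_le_iff₀ hα] at hn
  obtain ⟨C2, hC2, h2⟩ := KK_poly (2 * n) ha hab hb
  refine ⟨C1 ^ 4 * C2 ^ α, by positivity, ?_⟩
  intro s hs x
  have hs0 : 0 < s := ha.trans_le hs.1
  have hp := heatP_pos hfi hf0 hf1 hs0 x
  have hp1 := heatP_pos hfi hf0 hf1 one_pos x
  set p := heatP f s x with hpdef
  set p1 := heatP f 1 x with hp1def
  set M : ℝ := ∫ y, f y * ((1 + (x - y) ^ 2) ^ 2 * KK s (x - y)) with hM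
  set e : ℝ := M / p with he
  have hMe : M = e * p := by rw [he]; field_simp
  have hi2 := polyint hfi 2 hs0 x
  have hin := polyint hfi (2 * n) hs0 x
  have hi0 := KKint hfi hs0 x
  have hMp : p ≤ M := by
    rw [hpdef, heatP_eq', hM]
    refine integral_mono hi0 hi2 fun y => ?_
    have := KK_pos hs0 (x - y)
    have h0 := hf0 y
    have h3 : (1:ℝ) ≤ (1 + (x - y) ^ 2) ^ 2 := one_le_pow₀ (by nlinarith [sq_nonneg (x - y)])
    simp only
    gcongr
    nlinarith
  have he1 : 1 ≤ e := by rw [he, le_div_iff₀ hp]; linarith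
  -- Jensen
  have hJ : e ^ n * p ≤ C2 * p1 := by
    have hup : ∫ y, f y * ((1 + (x - y) ^ 2) ^ (2 * n) * KK s (x - y)) ≤ C2 * p1 := by
      rw [hp1def, heatP_eq', ← integral_const_mul]
      refine integral_mono hin ((KKint hfi one_pos x).const_mul _) fun y => ?_
      have h0 := hf0 y
      calc f y * ((1 + (x - y) ^ 2) ^ (2 * n) * KK s (x - y)) ≤ f y * (C2 * KK 1 (x - y)) :=
            mul_le_mul_of_nonneg_left (h2 s hs _) h0
        _ = _ := by ring
    refine le_trans ?_ hup
    have hlow : ∫ y, (e ^ n * (1 - n) * (f y * KK s (x - y)) +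
        e ^ n * n / e * (f y * ((1 + (x - y) ^ 2) ^ 2 * KK s (x - y)))) ≤
        ∫ y, f y * ((1 + (x - y) ^ 2) ^ (2 * n) * KK s (x - y)) := by
      refine integral_mono ((hi0.const_mul _).add (hi2.const_mul _)) hin fun y => ?_
      have hk := KK_pos hs0 (x - y)
      have h0 := hf0 y
      set A : ℝ := (1 + (x - y) ^ 2) ^ 2 with hA
      have hA0 : 0 ≤ A := by positivity
      have hb := one_add_mul_le_pow (a := A / e - 1) (by have : 0 ≤ A / e := by positivity
                                                         linarith) n
      rw [add_sub_cancel, div_pow, le_div_iff₀ (by positivity)] at hb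
      have : (1 + (x - y) ^ 2) ^ (2 * n) = A ^ n := by rw [hA, ← pow_mul]
      simp only [this]
      calc _ = f y * (((1 + n * (A / e - 1)) * e ^ n) * KK s (x - y)) := by ring
        _ ≤ f y * (A ^ n * KK s (x - y)) := by gcongr
    refine le_trans (le_of_eq ?_) hlow
    rw [integral_add (hi0.const_mul _) (hi2.const_mul _), integral_const_mul, integral_const_mul,
      ← heatP_eq', ← hM, ← hpdef, hMe]
    field_simp
    ring
  refine ⟨C1 * e, by nlinarith, ?_, ?_⟩
  · intro k
    rw [abs_div, abs_of_pos hp, div_le_iff₀ hp, mul_assoc, ← hMe, hM, ← integral_const_mul]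
    unfold PP
    refine (abs_integral_le_integral_abs).trans ?_
    refine integral_mono (PP_int hfi k hs0 x).abs (hi2.const_mul _) fun y => ?_
    have hk := KK_pos hs0 (x - y)
    have h0 := hf0 y
    simp only
    rw [abs_mul, abs_mul, abs_of_pos hk, abs_of_nonneg h0]
    calc f y * (|HH k s (x - y)| * KK s (x - y)) ≤ f y * (C1 * (1 + (x - y) ^ 2) ^ 2 * KK s (x - y)) := by
          gcongr; exact h1 k s hs.1 _
      _ = _ := by ring
  · have h4 : e ^ 4 ≤ (e ^ n) ^ α := by
      rw [← Real.rpow_natCast e n, ← Real.rpow_mul (by linarith), ← Real.rpow_natCast e 4]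
      apply Real.rpow_le_rpow_of_exponent_le he1
      exact_mod_cast hn
    calc (C1 * e) ^ 4 * p ^ α = C1 ^ 4 * (e ^ 4 * p ^ α) := by ring
      _ ≤ C1 ^ 4 * ((e ^ n) ^ α * p ^ α) := by gcongr
      _ = C1 ^ 4 * (e ^ n * p) ^ α := by rw [Real.mul_rpow (by positivity) hp.le]
      _ ≤ C1 ^ 4 * (C2 * p1) ^ α := by gcongr
      _ = C1 ^ 4 * C2 ^ α * p1 ^ α := by rw [Real.mul_rpow hC2.le hp1.le]; ring

/-! ### Concavity on `(0,1]` -/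

noncomputable def RR (f : ℝ → ℝ) (k : ℕ) (s x : ℝ) : ℝ := PP f k s x / heatP f s x

lemma heatP_dx {f : ℝ → ℝ} (hfi : Integrable f) {s : ℝ} (hs : 0 < s) (x : ℝ) :
    HasDerivAt (heatP f s) (PP f 1 s x) x := by
  have : heatP f s = PP f 0 s := funext fun x => heatP_eq f s x
  rw [this]; exact PP_dx hfi (by norm_num) hs x

lemma heatP_ds {f : ℝ → ℝ} (hfi : Integrable f) {s : ℝ} (hs : 0 < s) (x : ℝ) :
    HasDerivAt (fun s => heatP f s x) (PP f 2 s x / 2) s := by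
  simp only [heatP_eq]
  exact PP_ds hfi (Or.inl rfl) hs x

lemma heatP_cont {f : ℝ → ℝ} (hfi : Integrable f) {s : ℝ} (hs : 0 < s) : Continuous (heatP f s) :=
  continuous_iff_continuousAt.2 fun x => (heatP_dx hfi hs x).continuousAt

section
variable {f : ℝ → ℝ} (hfi : Integrable f) (hf0 : ∀ x, 0 ≤ f x) (hf1 : (∫ x : ℝ, f x) = 1)

lemma RR_dx (hfi : Integrable f) (hf0 : ∀ x, 0 ≤ f x) (hf1 : (∫ x : ℝ, f x) = 1)
    {k : ℕ} (hk : k ≤ 3) {s : ℝ} (hs : 0 < s) (x : ℝ) :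
    HasDerivAt (RR f k s) (RR f (k + 1) s x - RR f k s x * RR f 1 s x) x := by
  have hp := heatP_pos hfi hf0 hf1 hs x
  refine hd_congr ((PP_dx hfi hk hs x).div (heatP_dx hfi hs x) hp.ne') (fun _ => rfl) ?_
  unfold RR; field_simp

lemma RR2_ds (hfi : Integrable f) (hf0 : ∀ x, 0 ≤ f x) (hf1 : (∫ x : ℝ, f x) = 1)
    {s : ℝ} (hs : 0 < s) (x : ℝ) :
    HasDerivAt (fun s => RR f 2 s x) ((RR f 4 s x - RR f 2 s x ^ 2) / 2) s := by
  have hp := heatP_pos hfi hf0 hf1 hs x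
  refine hd_congr ((PP_ds hfi (Or.inr rfl) hs x).div (heatP_ds hfi hs x) hp.ne') (fun _ => rfl) ?_
  unfold RR; field_simp

lemma pa_dx (hfi : Integrable f) (hf0 : ∀ x, 0 ≤ f x) (hf1 : (∫ x : ℝ, f x) = 1)
    (α : ℝ) {s : ℝ} (hs : 0 < s) (x : ℝ) :
    HasDerivAt (fun x => heatP f s x ^ α) (α * RR f 1 s x * heatP f s x ^ α) x := by
  have hp := heatP_pos hfi hf0 hf1 hs x
  refine hd_congr ((heatP_dx hfi hs x).rpow_const (p := α) (Or.inl hp.ne')) (fun _ => rfl) ?_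
  rw [Real.rpow_sub_one hp.ne']
  unfold RR; field_simp

lemma pa_ds (hfi : Integrable f) (hf0 : ∀ x, 0 ≤ f x) (hf1 : (∫ x : ℝ, f x) = 1)
    (α : ℝ) {s : ℝ} (hs : 0 < s) (x : ℝ) :
    HasDerivAt (fun s => heatP f s x ^ α) (α / 2 * (RR f 2 s x * heatP f s x ^ α)) s := by
  have hp := heatP_pos hfi hf0 hf1 hs x
  refine hd_congr ((heatP_ds hfi hs x).rpow_const (p := α) (Or.inl hp.ne')) (fun _ => rfl) ?_
  rw [Real.rpow_sub_one hp.ne']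
  unfold RR; field_simp

lemma RR_meas (hfi : Integrable f) {k : ℕ} (hk : k ≤ 4) {s : ℝ} (hs : 0 < s) :
    Measurable (RR f k s) := by
  have h0 : Measurable (heatP f s) := (heatP_cont hfi hs).measurable
  have h1 : Measurable (PP f k s) := by
    rcases Nat.eq_zero_or_pos k with rfl | hk0
    · rwa [show PP f 0 s = heatP f s from (funext fun x => (heatP_eq f s x).symm)]
    · obtain ⟨j, rfl⟩ : ∃ j, k = j + 1 := ⟨k - 1, by omega⟩
      rw [show PP f (j + 1) s = deriv (PP f j s) from
        funext fun x => (PP_dx hfi (by omega) hs x).deriv.symm]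
      exact measurable_deriv _
  exact h1.div h0

lemma pa_meas (hfi : Integrable f) (α : ℝ) {s : ℝ} (hs : 0 < s) :
    Measurable (fun x => heatP f s x ^ α) :=
  (heatP_cont hfi hs).measurable.pow_const α

/-- integrability of polynomial expressions -/
lemma int_of_poly (hfi : Integrable f) (hf0 : ∀ x, 0 ≤ f x) (hf1 : (∫ x : ℝ, f x) = 1)
    {α : ℝ} (hα : 0 < α) (hI : Integrable (fun x => heatP f 1 x ^ α)) {s : ℝ} (hs : 0 < s) (hs1 : s < 1)
    {g : ℝ → ℝ} (hg : Measurable g)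
    (hb : ∀ x ρ, 1 ≤ ρ → (∀ k, |RR f k s x| ≤ ρ) → |g x| ≤ ρ ^ 4) :
    Integrable (fun x => g x * heatP f s x ^ α) := by
  obtain ⟨C, hC, h⟩ := key_bound hfi hf0 hf1 hα hs le_rfl hs1
  refine (hI.const_mul C).mono' (hg.mul (pa_meas hfi α hs)).aestronglyMeasurable
    (Eventually.of_forall fun x => ?_)
  obtain ⟨ρ, h1, h2, h3⟩ := h s ⟨le_rfl, le_rfl⟩ x
  have hp := heatP_pos hfi hf0 hf1 hs x
  have hpa : 0 < heatP f s x ^ α := Real.rpow_pos_of_pos hp α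
  rw [norm_mul, Real.norm_eq_abs, Real.norm_eq_abs, abs_of_pos hpa]
  refine le_trans ?_ h3
  gcongr
  exact hb x ρ h1 h2

lemma mono_bd1 {a ρ : ℝ} (hρ : 1 ≤ ρ) (ha : |a| ≤ ρ) : |a| ≤ ρ ^ 4 :=
  ha.trans (le_self_pow₀ hρ (by norm_num))

lemma mono_bd2 {a b ρ : ℝ} (hρ : 1 ≤ ρ) (ha : |a| ≤ ρ) (hb : |b| ≤ ρ) : |a * b| ≤ ρ ^ 4 := by
  rw [abs_mul]
  calc |a| * |b| ≤ ρ * ρ := by gcongr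
    _ = ρ ^ 2 := by ring
    _ ≤ ρ ^ 4 := pow_le_pow_right₀ hρ (by norm_num)

lemma mono_bd3 {a b c ρ : ℝ} (hρ : 1 ≤ ρ) (ha : |a| ≤ ρ) (hb : |b| ≤ ρ) (hc : |c| ≤ ρ) :
    |a * b * c| ≤ ρ ^ 4 := by
  rw [abs_mul, abs_mul]
  calc |a| * |b| * |c| ≤ ρ * ρ * ρ := by gcongr
    _ = ρ ^ 3 := by ring
    _ ≤ ρ ^ 4 := pow_le_pow_right₀ hρ (by norm_num)

lemma mono_bd4 {a b c d ρ : ℝ} (hρ : 1 ≤ ρ) (ha : |a| ≤ ρ) (hb : |b| ≤ ρ) (hc : |c| ≤ ρ)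
    (hd : |d| ≤ ρ) : |a * b * c * d| ≤ ρ ^ 4 := by
  rw [abs_mul, abs_mul, abs_mul]
  calc |a| * |b| * |c| * |d| ≤ ρ * ρ * ρ * ρ := by gcongr
    _ = ρ ^ 4 := by ring

lemma algebra_core {α A V2 V4 W1 W2 X : ℝ} (hα : 0 < α) (hαu : α ≤ 3 / 2 + Real.sqrt 2)
    (hA : 0 < A) (h1 : W1 = (1 - α) * V2) (h2 : 3 * X = (3 - α) * V4)
    (hq : ∀ a c : ℝ, 0 ≤ W2 + (a - 1) ^ 2 * V4 + c ^ 2 * A + 2 * (a - 1) * X + 2 * c * W1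
      + 2 * c * (a - 1) * V2)
    (hm : ∀ m : ℝ, 0 ≤ V4 - 2 * m * V2 + m ^ 2 * A) :
    α ^ 2 * V2 ^ 2 ≤ A * (2 * W2 - (2 - α) * X) := by
  have hX : X = (3 - α) / 3 * V4 := by linarith
  subst h1; subst hX
  set m := V2 / A with hmdef
  have hV2 : V2 = m * A := by rw [hmdef]; field_simp
  clear_value m; subst hV2
  have hv : m ^ 2 * A ≤ V4 := by nlinarith [hm m]
  have main : ∀ a : ℝ, 0 ≤ 2 * a * α / 3 - a ^ 2 - α ^ 2 / 6 + α / 6 →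
      0 ≤ α ^ 2 / 3 + α / 6 - 4 * a * α / 3 →
      α ^ 2 * (m * A) ^ 2 ≤ A * (2 * W2 - (2 - α) * ((3 - α) / 3 * V4)) := by
    intro a k1 k2
    have h := hq a ((α - a) * m)
    have e1 := mul_le_mul_of_nonneg_left hv k1
    have e2 : 0 ≤ (α ^ 2 / 3 + α / 6 - 4 * a * α / 3) * (m ^ 2 * A) := by positivity
    have key : α ^ 2 * (m ^ 2 * A) ≤ 2 * W2 - (2 - α) * ((3 - α) / 3 * V4) := by
      nlinarith
    calc α ^ 2 * (m * A) ^ 2 = A * (α ^ 2 * (m ^ 2 * A)) := by ring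
      _ ≤ _ := by gcongr
  by_cases hc : α ≤ 3 / 2
  · refine main (α / 3) ?_ ?_ <;> nlinarith
  · push Not at hc
    have hs : (α - 3 / 2) ^ 2 ≤ 2 := by
      have := Real.sq_sqrt (show (0:ℝ) ≤ 2 by norm_num)
      have h0 := Real.sqrt_nonneg 2
      nlinarith
    refine main (α / 4 + 1 / 8) ?_ ?_ <;> nlinarith

lemma iadd {g h : ℝ → ℝ} (hg : Integrable g) (hh : Integrable h) : Integrable (fun x => g x + h x) :=
  hg.add hh

lemma isub {g h : ℝ → ℝ} (hg : Integrable g) (hh : Integrable h) : Integrable (fun x => g x - h x) :=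
  hg.sub hh

lemma core (hfi : Integrable f) (hf0 : ∀ x, 0 ≤ f x) (hf1 : (∫ x : ℝ, f x) = 1)
    {α : ℝ} (hα : 0 < α) (hαu : α ≤ 3 / 2 + Real.sqrt 2)
    (hI : Integrable (fun x => heatP f 1 x ^ α)) {s : ℝ} (hs : 0 < s) (hs1 : s < 1)
    (hA : 0 < ∫ x, heatP f s x ^ α) :
    ∃ V2 D : ℝ, (∫ x, RR f 2 s x * heatP f s x ^ α) = (1 - α) * V2 ∧
      (∫ x, ((α - 1) * RR f 2 s x ^ 2 + RR f 4 s x) * heatP f s x ^ α) = (α - 1) * D ∧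
      α ^ 2 * V2 ^ 2 ≤ (∫ x, heatP f s x ^ α) * D := by
  have m1 := RR_meas hfi (k := 1) (by norm_num) hs
  have m2 := RR_meas hfi (k := 2) (by norm_num) hs
  have m3 := RR_meas hfi (k := 3) (by norm_num) hs
  have m4 := RR_meas hfi (k := 4) (by norm_num) hs
  have d1 := fun x => RR_dx hfi hf0 hf1 (k := 1) (by norm_num) hs x
  have d2 := fun x => RR_dx hfi hf0 hf1 (k := 2) (by norm_num) hs x
  have d3 := fun x => RR_dx hfi hf0 hf1 (k := 3) (by norm_num) hs x
  have dq := fun x => pa_dx hfi hf0 hf1 α hs x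
  have hqpos : ∀ x, 0 < heatP f s x ^ α := fun x => Real.rpow_pos_of_pos (heatP_pos hfi hf0 hf1 hs x) α
  have I : ∀ {g : ℝ → ℝ}, Measurable g →
    (∀ x ρ, 1 ≤ ρ → (∀ k, |RR f k s x| ≤ ρ) → |g x| ≤ ρ ^ 4) →
    Integrable (fun x => g x * heatP f s x ^ α) := fun hg hb => int_of_poly hfi hf0 hf1 hα hI hs hs1 hg hb
  have iq : Integrable (fun x => heatP f s x ^ α) := by
    have := I (g := fun _ => 1) measurable_const (fun x ρ h _ => by
      rw [abs_one]; exact one_le_pow₀ h)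
    simpa using this
  simp only [Nat.reduceAdd] at d1 d2 d3
  set v := RR f 1 s with hv
  set w := RR f 2 s with hw
  set r := RR f 3 s with hr
  set u := RR f 4 s with hu
  set q := fun x => heatP f s x ^ α with hq
  have j1 : Integrable (fun x => v x * q x) := I m1 fun x ρ h hk => mono_bd1 h (hk 1)
  have j2 : Integrable (fun x => w x * q x) := I m2 fun x ρ h hk => mono_bd1 h (hk 2)
  have j3 : Integrable (fun x => r x * q x) := I m3 fun x ρ h hk => mono_bd1 h (hk 3)
  have j4 : Integrable (fun x => u x * q x) := I m4 fun x ρ h hk => mono_bd1 h (hk 4)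
  have j11 : Integrable (fun x => (v x * v x) * q x) := I (m1.mul m1) fun x ρ h hk => mono_bd2 h (hk 1) (hk 1)
  have j12 : Integrable (fun x => (v x * w x) * q x) := I (m1.mul m2) fun x ρ h hk => mono_bd2 h (hk 1) (hk 2)
  have j22 : Integrable (fun x => (w x * w x) * q x) := I (m2.mul m2) fun x ρ h hk => mono_bd2 h (hk 2) (hk 2)
  have j13 : Integrable (fun x => (v x * r x) * q x) := I (m1.mul m3) fun x ρ h hk => mono_bd2 h (hk 1) (hk 3)
  have j111 : Integrable (fun x => (v x * v x * v x) * q x) :=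
    I ((m1.mul m1).mul m1) fun x ρ h hk => mono_bd3 h (hk 1) (hk 1) (hk 1)
  have j112 : Integrable (fun x => (v x * v x * w x) * q x) :=
    I ((m1.mul m1).mul m2) fun x ρ h hk => mono_bd3 h (hk 1) (hk 1) (hk 2)
  have j1111 : Integrable (fun x => (v x * v x * v x * v x) * q x) :=
    I (((m1.mul m1).mul m1).mul m1) fun x ρ h hk => mono_bd4 h (hk 1) (hk 1) (hk 1) (hk 1)
  set A := ∫ x, q x with hAdef
  -- integration by parts
  have i1 : (∫ x, w x * q x) + (α - 1) * (∫ x, v x * v x * q x) = 0 := by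
    rw [← integral_const_mul, ← integral_add j2 (j11.const_mul _)]
    refine integral_eq_zero_of_hasDerivAt_of_integrable (f := fun x => v x * q x) (fun x => ?_)
      (j2.add (j11.const_mul _)) j1
    exact hd_congr ((d1 x).mul (dq x)) (fun _ => rfl) (by simp only [hq]; ring)
  have i2 : 3 * (∫ x, v x * v x * w x * q x) + (α - 3) * (∫ x, v x * v x * v x * v x * q x) = 0 := by
    rw [← integral_const_mul, ← integral_const_mul, ← integral_add (j112.const_mul _) (j1111.const_mul _)]
    refine integral_eq_zero_of_hasDerivAt_of_integrable (f := fun x => v x * v x * v x * q x) (fun x => ?_)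
      ((j112.const_mul _).add (j1111.const_mul _)) j111
    exact hd_congr ((((d1 x).mul (d1 x)).mul (d1 x)).mul (dq x)) (fun _ => rfl)
      (by simp only [hq, Pi.mul_apply]; ring)
  have i3 : (∫ x, u x * q x) + (α - 1) * (∫ x, v x * r x * q x) = 0 := by
    rw [← integral_const_mul, ← integral_add j4 (j13.const_mul _)]
    refine integral_eq_zero_of_hasDerivAt_of_integrable (f := fun x => r x * q x) (fun x => ?_)
      (j4.add (j13.const_mul _)) j3
    exact hd_congr ((d3 x).mul (dq x)) (fun _ => rfl) (by simp only [hq]; ring)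
  have i4 : (∫ x, w x * w x * q x) + (∫ x, v x * r x * q x) + (α - 2) * (∫ x, v x * v x * w x * q x) = 0 := by
    rw [← integral_const_mul, ← integral_add j22 j13, ← integral_add (iadd j22 j13) (j112.const_mul _)]
    refine integral_eq_zero_of_hasDerivAt_of_integrable (f := fun x => v x * w x * q x) (fun x => ?_)
      ((j22.add j13).add (j112.const_mul _)) j12
    exact hd_congr (((d1 x).mul (d2 x)).mul (dq x)) (fun _ => rfl)
      (by simp only [hq, Pi.mul_apply]; ring)
  refine ⟨∫ x, v x * v x * q x,
    2 * (∫ x, w x * w x * q x) - (2 - α) * (∫ x, v x * v x * w x * q x), by linarith, ?_, ?_⟩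
  · have : (∫ x, ((α - 1) * w x ^ 2 + u x) * q x) =
        (α - 1) * (∫ x, w x * w x * q x) + (∫ x, u x * q x) := by
      rw [← integral_const_mul, ← integral_add (j22.const_mul _) j4]
      congr 1; ext x; ring
    rw [this]
    have h3 : (∫ x, u x * q x) = -(α - 1) * (∫ x, v x * r x * q x) := by linarith
    have h4 : (∫ x, v x * r x * q x) = - (∫ x, w x * w x * q x) - (α - 2) * (∫ x, v x * v x * w x * q x) := by
      linarith
    rw [h3, h4]; ring
  · refine algebra_core (W1 := ∫ x, w x * q x) (V4 := ∫ x, v x * v x * v x * v x * q x) hα hαu hA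
      (by linarith) (by linarith) ?_ ?_
    · intro a c
      have h : 0 ≤ ∫ x, (w x + (a - 1) * v x ^ 2 + c) ^ 2 * q x :=
        integral_nonneg fun x => mul_nonneg (sq_nonneg _) (hqpos x).le
      refine h.trans (le_of_eq ?_)
      rw [hAdef, ← integral_const_mul, ← integral_const_mul, ← integral_const_mul, ← integral_const_mul,
        ← integral_const_mul,
        ← integral_add j22 (j1111.const_mul _),
        ← integral_add (iadd j22 (j1111.const_mul _)) (iq.const_mul _),
        ← integral_add (iadd (iadd j22 (j1111.const_mul _)) (iq.const_mul _)) (j112.const_mul _),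
        ← integral_add (iadd (iadd (iadd j22 (j1111.const_mul _)) (iq.const_mul _)) (j112.const_mul _))
          (j2.const_mul _),
        ← integral_add (iadd (iadd (iadd (iadd j22 (j1111.const_mul _)) (iq.const_mul _)) (j112.const_mul _))
          (j2.const_mul _)) (j11.const_mul _)]
      congr 1; ext x; ring
    · intro m
      have h : 0 ≤ ∫ x, (v x ^ 2 - m) ^ 2 * q x :=
        integral_nonneg fun x => mul_nonneg (sq_nonneg _) (hqpos x).le
      refine h.trans (le_of_eq ?_)
      rw [hAdef, ← integral_const_mul, ← integral_const_mul, ← integral_sub j1111 (j11.const_mul _),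
        ← integral_add (isub j1111 (j11.const_mul _)) (iq.const_mul _)]
      congr 1; ext x; ring

end

lemma A_int {f : ℝ → ℝ} (hfi : Integrable f) (hf0 : ∀ x, 0 ≤ f x) (hf1 : (∫ x : ℝ, f x) = 1)
    {α : ℝ} (hα : 0 < α) (hI : Integrable (fun x => heatP f 1 x ^ α)) {s : ℝ} (hs : 0 < s) (hs1 : s ≤ 1) :
    Integrable (fun x => heatP f s x ^ α) := by
  refine (hI.const_mul (Real.sqrt (1 / s) ^ α)).mono' (pa_meas hfi α hs).aestronglyMeasurable
    (Eventually.of_forall fun x => ?_)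
  have hp := heatP_pos hfi hf0 hf1 hs x
  have hp1 := heatP_pos hfi hf0 hf1 one_pos x
  rw [Real.norm_eq_abs, abs_of_pos (Real.rpow_pos_of_pos hp α), ← Real.mul_rpow (by positivity) hp1.le]
  exact Real.rpow_le_rpow hp.le (heatP_le hfi hf0 hs hs1 x) hα.le

lemma A_pos {f : ℝ → ℝ} (hfi : Integrable f) (hf0 : ∀ x, 0 ≤ f x) (hf1 : (∫ x : ℝ, f x) = 1)
    {α : ℝ} {s : ℝ} (hs : 0 < s) (hI : Integrable (fun x => heatP f s x ^ α)) :
    0 < ∫ x, heatP f s x ^ α := by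
  have hpos : ∀ x, 0 < heatP f s x ^ α := fun x => Real.rpow_pos_of_pos (heatP_pos hfi hf0 hf1 hs x) α
  rw [integral_pos_iff_support_of_nonneg (fun x => (hpos x).le) hI]
  have : Function.support (fun x => heatP f s x ^ α) = Set.univ := by
    ext x; simp [(hpos x).ne']
  rw [this]; simp

lemma A_cont {f : ℝ → ℝ} (hfi : Integrable f) (hf0 : ∀ x, 0 ≤ f x) (hf1 : (∫ x : ℝ, f x) = 1)
    {α : ℝ} (hα : 0 < α) (hI : Integrable (fun x => heatP f 1 x ^ α)) :
    ContinuousOn (fun s => ∫ x, heatP f s x ^ α) (Set.Ioc 0 1) := by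
  have key : ∀ a : ℝ, 0 < a → ContinuousOn (fun s => ∫ x, heatP f s x ^ α) (Set.Icc a 1) := by
    intro a ha
    refine continuousOn_of_dominated (bound := fun x => Real.sqrt (1 / a) ^ α * heatP f 1 x ^ α)
      ?_ ?_ (hI.const_mul _) ?_
    · intro s hs; exact (pa_meas hfi α (ha.trans_le hs.1)).aestronglyMeasurable
    · intro s hs
      have hs0 := ha.trans_le hs.1
      refine Eventually.of_forall fun x => ?_
      have hp := heatP_pos hfi hf0 hf1 hs0 x
      have hp1 := heatP_pos hfi hf0 hf1 one_pos x
      rw [Real.norm_eq_abs, abs_of_pos (Real.rpow_pos_of_pos hp α), ← Real.mul_rpow (by positivity) hp1.le]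
      refine Real.rpow_le_rpow hp.le ((heatP_le hfi hf0 hs0 hs.2 x).trans ?_) hα.le
      have : Real.sqrt (1 / s) ≤ Real.sqrt (1 / a) := by
        apply Real.sqrt_le_sqrt
        have := hs.1
        gcongr
      gcongr
    · refine Eventually.of_forall fun x s hs => ?_
      exact (pa_ds hfi hf0 hf1 α (ha.trans_le hs.1) x).continuousAt.continuousWithinAt
  intro s hs
  have h := key (s / 2) (by linarith [hs.1]) s ⟨by linarith [hs.1], hs.2⟩
  refine h.mono_of_mem_nhdsWithin ?_
  have : Set.Ioi (s / 2) ∈ nhds s := Ioi_mem_nhds (by linarith [hs.1])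
  filter_upwards [mem_nhdsWithin_of_mem_nhds this, self_mem_nhdsWithin] with y hy hy2
  exact ⟨le_of_lt hy, hy2.2⟩

lemma A_ds {f : ℝ → ℝ} (hfi : Integrable f) (hf0 : ∀ x, 0 ≤ f x) (hf1 : (∫ x : ℝ, f x) = 1)
    {α : ℝ} (hα : 0 < α) (hI : Integrable (fun x => heatP f 1 x ^ α)) {s : ℝ} (hs : 0 < s) (hs1 : s < 1) :
    HasDerivAt (fun s => ∫ x, heatP f s x ^ α) (α / 2 * ∫ x, RR f 2 s x * heatP f s x ^ α) s ∧
    HasDerivAt (fun s => ∫ x, RR f 2 s x * heatP f s x ^ α)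
      (1 / 2 * ∫ x, ((α - 1) * RR f 2 s x ^ 2 + RR f 4 s x) * heatP f s x ^ α) s := by
  have hn : Set.Ioo (s / 2) ((s + 1) / 2) ∈ nhds s := Ioo_mem_nhds (by linarith) (by linarith)
  obtain ⟨C, hC, h⟩ := key_bound hfi hf0 hf1 hα (a := s / 2) (b := (s + 1) / 2)
    (by linarith) (by linarith) (by linarith)
  have m2 := fun {u : ℝ} (hu : 0 < u) => RR_meas hfi (k := 2) (by norm_num) hu
  have m4 := fun {u : ℝ} (hu : 0 < u) => RR_meas hfi (k := 4) (by norm_num) hu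
  have mq := fun {u : ℝ} (hu : 0 < u) => pa_meas hfi α hu
  have i2 : Integrable (fun x => RR f 2 s x * heatP f s x ^ α) :=
    int_of_poly hfi hf0 hf1 hα hI hs hs1 (m2 hs) fun x ρ h hk => mono_bd1 h (hk 2)
  constructor
  · rw [← integral_const_mul]
    refine (hasDerivAt_integral_of_dominated_loc_of_deriv_le (μ := volume)
      (F := fun s x => heatP f s x ^ α)
      (F' := fun s x => α / 2 * (RR f 2 s x * heatP f s x ^ α))
      (bound := fun x => α / 2 * (C * heatP f 1 x ^ α)) hn ?_ ?_ ?_ ?_ ?_ ?_).2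
    · filter_upwards [hn] with u hu
      exact (mq (by linarith [hu.1])).aestronglyMeasurable
    · exact A_int hfi hf0 hf1 hα hI hs hs1.le
    · exact (i2.const_mul _).aestronglyMeasurable
    · refine Eventually.of_forall fun x u hu => ?_
      obtain ⟨ρ, h1, h2, h3⟩ := h u ⟨hu.1.le, hu.2.le⟩ x
      have hpa : 0 < heatP f u x ^ α :=
        Real.rpow_pos_of_pos (heatP_pos hfi hf0 hf1 (by linarith [hu.1]) x) α
      rw [norm_mul, norm_mul, Real.norm_eq_abs, Real.norm_eq_abs, Real.norm_eq_abs, abs_of_pos hpa,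
        abs_of_pos (by positivity : 0 < α / 2)]
      have hb : |RR f 2 u x| ≤ ρ ^ 4 := mono_bd1 h1 (h2 2)
      have : |RR f 2 u x| * heatP f u x ^ α ≤ C * heatP f 1 x ^ α := le_trans (by gcongr) h3
      gcongr
    · exact (hI.const_mul C).const_mul _
    · refine Eventually.of_forall fun x u hu => ?_
      exact pa_ds hfi hf0 hf1 α (by linarith [hu.1]) x
  · rw [← integral_const_mul]
    refine (hasDerivAt_integral_of_dominated_loc_of_deriv_le (μ := volume)
      (F := fun s x => RR f 2 s x * heatP f s x ^ α)
      (F' := fun s x => 1 / 2 * (((α - 1) * RR f 2 s x ^ 2 + RR f 4 s x) * heatP f s x ^ α))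
      (bound := fun x => (|α - 1| + 1) * (C * heatP f 1 x ^ α)) hn ?_ i2 ?_ ?_ ?_ ?_).2
    · filter_upwards [hn] with u hu
      have hu0 : 0 < u := by linarith [hu.1]
      exact ((m2 hu0).mul (mq hu0)).aestronglyMeasurable
    · have := m2 hs
      have := m4 hs
      have := mq hs
      apply Measurable.aestronglyMeasurable
      fun_prop
    · refine Eventually.of_forall fun x u hu => ?_
      obtain ⟨ρ, h1, h2, h3⟩ := h u ⟨hu.1.le, hu.2.le⟩ x
      have hpa : 0 < heatP f u x ^ α :=
        Real.rpow_pos_of_pos (heatP_pos hfi hf0 hf1 (by linarith [hu.1]) x) α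
      have hb : |RR f 2 u x * RR f 2 u x| ≤ ρ ^ 4 := mono_bd2 h1 (h2 2) (h2 2)
      have hb4 : |RR f 4 u x| ≤ ρ ^ 4 := mono_bd1 h1 (h2 4)
      have hb5 : |(α - 1) * RR f 2 u x ^ 2 + RR f 4 u x| ≤ (|α - 1| + 1) * ρ ^ 4 := by
        refine (abs_add_le _ _).trans ?_
        rw [abs_mul, sq]
        have := abs_nonneg (α - 1)
        nlinarith
      rw [norm_mul, norm_mul, Real.norm_eq_abs, Real.norm_eq_abs, Real.norm_eq_abs, abs_of_pos hpa,
        abs_of_pos (by positivity : (0:ℝ) < 1 / 2)]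
      calc 1 / 2 * (|(α - 1) * RR f 2 u x ^ 2 + RR f 4 u x| * heatP f u x ^ α)
          ≤ 1 * (((|α - 1| + 1) * ρ ^ 4) * heatP f u x ^ α) := by gcongr; norm_num
        _ = (|α - 1| + 1) * (ρ ^ 4 * heatP f u x ^ α) := by ring
        _ ≤ _ := by gcongr
    · exact (hI.const_mul C).const_mul _
    · refine Eventually.of_forall fun x u hu => ?_
      have hu0 : 0 < u := by linarith [hu.1]
      exact hd_congr ((RR2_ds hfi hf0 hf1 hu0 x).mul (pa_ds hfi hf0 hf1 α hu0 x)) (fun _ => rfl) (by ring)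

lemma concave_A {f : ℝ → ℝ} (hfi : Integrable f) (hf0 : ∀ x, 0 ≤ f x) (hf1 : (∫ x : ℝ, f x) = 1)
    {α : ℝ} (hα : 0 < α) (hαu : α ≤ 3 / 2 + Real.sqrt 2) (hα1 : α ≠ 1)
    (hI : Integrable (fun x => heatP f 1 x ^ α)) :
    ConcaveOn ℝ (Set.Ioc 0 1) (fun s => (∫ x, heatP f s x ^ α) ^ (1 - α)⁻¹) := by
  set β := (1 - α)⁻¹ with hβ
  have h1α : 1 - α ≠ 0 := sub_ne_zero.2 hα1.symm
  have hβ1 : β * (1 - α) = 1 := inv_mul_cancel₀ h1α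
  have hApos : ∀ s ∈ Set.Ioc (0:ℝ) 1, 0 < ∫ x, heatP f s x ^ α := fun s hs =>
    A_pos hfi hf0 hf1 hs.1 (A_int hfi hf0 hf1 hα hI hs.1 hs.2)
  set A : ℝ → ℝ := fun s => ∫ x, heatP f s x ^ α with hA
  set J : ℝ → ℝ := fun s => ∫ x, RR f 2 s x * heatP f s x ^ α with hJ
  set L : ℝ → ℝ := fun s => ∫ x, ((α - 1) * RR f 2 s x ^ 2 + RR f 4 s x) * heatP f s x ^ α with hL
  refine concaveOn_of_hasDerivWithinAt2_nonpos (convex_Ioc 0 1)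
    (f' := fun s => α / 2 * J s * β * A s ^ (β - 1))
    (f'' := fun s => α / 2 * (1 / 2 * L s) * β * A s ^ (β - 1) +
      α / 2 * J s * β * (α / 2 * J s * (β - 1) * A s ^ (β - 1 - 1))) ?_ ?_ ?_ ?_
  · exact (A_cont hfi hf0 hf1 hα hI).rpow_const fun s hs => Or.inl (hApos s hs).ne'
  · rw [interior_Ioc]
    intro s hs
    have hp := hApos s ⟨hs.1, hs.2.le⟩
    exact ((A_ds hfi hf0 hf1 hα hI hs.1 hs.2).1.rpow_const (Or.inl hp.ne')).hasDerivWithinAt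
  · rw [interior_Ioc]
    intro s hs
    have hp := hApos s ⟨hs.1, hs.2.le⟩
    obtain ⟨hd1, hd2⟩ := A_ds hfi hf0 hf1 hα hI hs.1 hs.2
    have hr := hd1.rpow_const (p := β - 1) (Or.inl hp.ne')
    exact (((hd2.const_mul (α / 2)).mul_const β).mul hr).hasDerivWithinAt
  · rw [interior_Ioc]
    intro s hs
    have hp := hApos s ⟨hs.1, hs.2.le⟩
    obtain ⟨V2, D, e1, e2, e3⟩ := core hfi hf0 hf1 hα hαu hI hs.1 hs.2 hp
    change J s = _ at e1
    change L s = _ at e2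
    change _ ≤ A s * D at e3
    rw [e1, e2]
    have hsp : A s ^ (β - 1) = A s ^ (β - 1 - 1) * A s := by
      rw [← Real.rpow_add_one hp.ne']; congr 1; ring
    rw [hsp]
    have hq : 0 < A s ^ (β - 1 - 1) := Real.rpow_pos_of_pos hp _
    have hb2 : (β - 1) * (1 - α) = α := by linarith
    have : α / 2 * (1 / 2 * ((α - 1) * D)) * β * (A s ^ (β - 1 - 1) * A s) +
      α / 2 * ((1 - α) * V2) * β * (α / 2 * ((1 - α) * V2) * (β - 1) * A s ^ (β - 1 - 1)) =
      A s ^ (β - 1 - 1) * (α / 4) * (α * V2 ^ 2 * ((β * (1 - α)) * ((β - 1) * (1 - α)))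
        - (β * (1 - α)) * (A s * D)) := by ring
    rw [this, hb2, hβ1]
    apply mul_nonpos_of_nonneg_of_nonpos (by positivity)
    nlinarith

/-! ### Jensen, limits and conclusion -/

lemma KK_gauss {s : ℝ} (hs : 0 < s) (x y : ℝ) :
    KK s (x - y) = ProbabilityTheory.gaussianPDFReal x s.toNNReal y := by
  unfold KK ProbabilityTheory.gaussianPDFReal
  rw [Real.coe_toNNReal s hs.le]
  rw [show (x - y) ^ 2 = (y - x) ^ 2 by ring]

lemma KK_gauss0 {s : ℝ} (hs : 0 < s) :
    KK s = ProbabilityTheory.gaussianPDFReal 0 s.toNNReal := by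
  ext z
  unfold KK ProbabilityTheory.gaussianPDFReal
  simp [Real.coe_toNNReal s hs.le]

lemma KK_integrable {s : ℝ} (hs : 0 < s) : Integrable (KK s) := by
  rw [KK_gauss0 hs]; exact ProbabilityTheory.integrable_gaussianPDFReal _ _

lemma nn_ne {s : ℝ} (hs : 0 < s) : s.toNNReal ≠ 0 := (Real.toNNReal_pos.2 hs).ne'

lemma KK_integral {s : ℝ} (hs : 0 < s) : ∫ z, KK s z = 1 := by
  rw [KK_gauss0 hs]; exact ProbabilityTheory.integral_gaussianPDFReal_eq_one _ (nn_ne hs)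

lemma conv_int {g : ℝ → ℝ} (hg : Integrable g) {s : ℝ} (hs : 0 < s) :
    Integrable (fun x => ∫ y, g y * KK s (x - y)) :=
  Integrable.integrable_convolution (ContinuousLinearMap.mul ℝ ℝ) hg (KK_integrable hs)

lemma conv_integral {g : ℝ → ℝ} (hg : Integrable g) {s : ℝ} (hs : 0 < s) :
    ∫ x, ∫ y, g y * KK s (x - y) = ∫ y, g y := by
  have := integral_convolution (ContinuousLinearMap.mul ℝ ℝ) hg (KK_integrable hs)
  rw [KK_integral hs] at this
  simpa [convolution] using this

lemma jensen_point {f : ℝ → ℝ} (hfi : Integrable f) (hf0 : ∀ x, 0 ≤ f x) {φ : ℝ → ℝ}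
    (hφ : ConvexOn ℝ (Set.Ici 0) φ) (hφc : ContinuousOn φ (Set.Ici 0))
    (hi : Integrable (fun x => φ (f x))) {s : ℝ} (hs : 0 < s) (x : ℝ) :
    φ (heatP f s x) ≤ ∫ y, φ (f y) * KK s (x - y) := by
  have hv := nn_ne hs
  have e : ∀ g : ℝ → ℝ, ∫ y, g y ∂(ProbabilityTheory.gaussianReal x s.toNNReal) =
      ∫ y, g y * KK s (x - y) := by
    intro g
    rw [ProbabilityTheory.integral_gaussianReal_eq_integral_smul hv]
    congr 1; ext y
    rw [KK_gauss hs, smul_eq_mul, mul_comm]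
  have ei : ∀ g : ℝ → ℝ, Integrable g → Integrable g (ProbabilityTheory.gaussianReal x s.toNNReal) := by
    intro g hg
    rw [ProbabilityTheory.gaussianReal_of_var_ne_zero _ hv,
      integrable_withDensity_iff_integrable_smul' (ProbabilityTheory.measurable_gaussianPDF _ _)
        (Eventually.of_forall fun y => ENNReal.ofReal_lt_top)]
    refine (KKint hg hs x).congr (Eventually.of_forall fun y => ?_)
    simp only [smul_eq_mul, ProbabilityTheory.gaussianPDF]
    rw [ENNReal.toReal_ofReal (ProbabilityTheory.gaussianPDFReal_nonneg _ _ _), KK_gauss hs, mul_comm]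
  have h := hφ.map_integral_le (μ := ProbabilityTheory.gaussianReal x s.toNNReal) (f := f) hφc isClosed_Ici
    (Eventually.of_forall fun y => hf0 y) (ei f hfi) (ei _ hi)
  rw [e f, e (fun y => φ (f y))] at h
  exact h

lemma jensen_flow {f : ℝ → ℝ} (hfi : Integrable f) (hf0 : ∀ x, 0 ≤ f x) {φ : ℝ → ℝ}
    (hφ : ConvexOn ℝ (Set.Ici 0) φ) (hφc : ContinuousOn φ (Set.Ici 0))
    (hi : Integrable (fun x => φ (f x))) {s : ℝ} (hs : 0 < s)
    (hs' : Integrable (fun x => φ (heatP f s x))) :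
    ∫ x, φ (heatP f s x) ≤ ∫ x, φ (f x) := by
  rw [← conv_integral hi hs]
  exact integral_mono hs' (conv_int hi hs) fun x => jensen_point hfi hf0 hφ hφc hi hs x

lemma renyi_limit {p : ℝ → ℝ} (hp : ∀ x, 0 < p x) (hm : Measurable p) (hpi : Integrable p)
    (hp1 : ∫ x, p x = 1) {B : ℝ} (hB : ∀ x, p x ≤ B)
    (hl : Integrable (fun x => p x * Real.log (p x))) :
    Tendsto (fun α : ℝ => (∫ x, p x ^ α) ^ (1 - α)⁻¹) (nhdsWithin 1 (Set.Ioi 1))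
      (nhds (Real.exp (-∫ x, p x * Real.log (p x)))) := by
  set A : ℝ → ℝ := fun α => ∫ x, p x ^ α with hA
  set B' := max 1 B with hB'
  have hB1 : 1 ≤ B' := le_max_left _ _
  have hpB : ∀ x, p x ≤ B' := fun x => (hB x).trans (le_max_right _ _)
  have hA1 : A 1 = 1 := by simp [hA, hp1]
  have hIoo : Set.Ioo (1:ℝ) 2 ∈ nhdsWithin (1:ℝ) (Set.Ioi 1) := Ioo_mem_nhdsGT (by norm_num)
  have hpowInt : ∀ α ∈ Set.Ioo (1:ℝ) 2, Integrable (fun x => p x ^ α) := by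
    intro α hα
    refine (hpi.const_mul B').mono' (hm.pow_const α).aestronglyMeasurable (Eventually.of_forall fun x => ?_)
    rw [Real.norm_eq_abs, abs_of_pos (Real.rpow_pos_of_pos (hp x) α)]
    have e : p x ^ α = p x ^ (α - 1) * p x := by
      rw [← Real.rpow_add_one (hp x).ne']; congr 1; ring
    rw [e]
    have : p x ^ (α - 1) ≤ B' := by
      calc p x ^ (α - 1) ≤ B' ^ (α - 1) := Real.rpow_le_rpow (hp x).le (hpB x) (by linarith [hα.1])
        _ ≤ B' ^ (1:ℝ) := Real.rpow_le_rpow_of_exponent_le hB1 (by linarith [hα.2])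
        _ = B' := Real.rpow_one _
    have := hp x
    gcongr
  have hderA : HasDerivWithinAt A (∫ x, p x * Real.log (p x)) (Set.Ioi 1) 1 := by
    rw [hasDerivWithinAt_iff_tendsto_slope' (by simp)]
    have hslope : (fun α => ∫ x, (α - 1)⁻¹ * (p x ^ α - p x)) =ᶠ[nhdsWithin 1 (Set.Ioi 1)] slope A 1 := by
      filter_upwards [hIoo] with α hα
      rw [slope_def_field, hA1, integral_const_mul, integral_sub (hpowInt α hα) hpi, hp1]
      simp only [hA]; rw [div_eq_inv_mul]
    refine Tendsto.congr' hslope ?_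
    refine tendsto_integral_filter_of_dominated_convergence (fun x => B' * |p x * Real.log (p x)|) ?_ ?_ ?_ ?_
    · refine Eventually.of_forall fun α => ?_
      exact (((hm.pow_const α).sub hm).const_mul _).aestronglyMeasurable
    · filter_upwards [hIoo] with α hα
      refine Eventually.of_forall fun x => ?_
      have hα1 : 0 < α - 1 := by linarith [hα.1]
      have hx := hp x
      have e : p x ^ α = p x * p x ^ (α - 1) := by
        rw [mul_comm, ← Real.rpow_add_one hx.ne']; congr 1; ring
      have hle : p x ^ (α - 1) ≤ B' := by
        calc p x ^ (α - 1) ≤ B' ^ (α - 1) := Real.rpow_le_rpow hx.le (hpB x) hα1.le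
          _ ≤ B' ^ (1:ℝ) := Real.rpow_le_rpow_of_exponent_le hB1 (by linarith [hα.2])
          _ = B' := Real.rpow_one _
      have hexp : p x ^ (α - 1) = Real.exp (Real.log (p x) * (α - 1)) := Real.rpow_def_of_pos hx _
      rw [hexp] at hle e
      set u := Real.log (p x) * (α - 1) with hu
      have h1 := Real.add_one_le_exp u
      have h2 := Real.add_one_le_exp (-u)
      have h3 : Real.exp (-u) * Real.exp u = 1 := by rw [← Real.exp_add]; simp
      have h4 : Real.exp u - 1 ≤ u * Real.exp u := by nlinarith [Real.exp_pos u]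
      have h5 : |Real.exp u - 1| ≤ B' * |u| := by
        rw [abs_le]
        constructor
        · nlinarith [neg_abs_le u, abs_nonneg u]
        · nlinarith [le_abs_self u, abs_nonneg u, Real.exp_pos u]
      rw [e, Real.norm_eq_abs]
      rw [show (α - 1)⁻¹ * (p x * Real.exp u - p x) = (α - 1)⁻¹ * p x * (Real.exp u - 1) by ring,
        abs_mul, abs_of_pos (by positivity : 0 < (α - 1)⁻¹ * p x)]
      calc (α - 1)⁻¹ * p x * |Real.exp u - 1| ≤ (α - 1)⁻¹ * p x * (B' * |u|) := by gcongr
        _ = B' * |p x * Real.log (p x)| := by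
          rw [hu, abs_mul, abs_mul, abs_of_pos hα1, abs_of_pos hx]; field_simp
    · exact hl.abs.const_mul _
    · refine Eventually.of_forall fun x => ?_
      have h : HasDerivAt (fun α : ℝ => p x ^ α) (p x ^ (1:ℝ) * Real.log (p x)) 1 :=
        (Real.hasStrictDerivAt_const_rpow (hp x) 1).hasDerivAt
      have h2 := (hasDerivWithinAt_iff_tendsto_slope' (s := Set.Ioi 1) (by simp)).1 h.hasDerivWithinAt
      rw [Real.rpow_one] at h2
      refine h2.congr fun α => ?_
      rw [slope_def_field, Real.rpow_one, div_eq_inv_mul]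
  have hlog := hderA.log (by rw [hA1]; norm_num)
  rw [hasDerivWithinAt_iff_tendsto_slope' (by simp), hA1, div_one] at hlog
  refine Tendsto.congr' ?_ (Real.continuous_exp.continuousAt.tendsto.comp hlog.neg)
  filter_upwards [hIoo] with α hα
  have hAp : 0 < A α := by
    rw [hA]
    simp only
    rw [integral_pos_iff_support_of_nonneg (fun x => (Real.rpow_pos_of_pos (hp x) α).le) (hpowInt α hα)]
    have : Function.support (fun x => p x ^ α) = Set.univ := by
      ext x; simp [(Real.rpow_pos_of_pos (hp x) α).ne']
    rw [this]; simp
  simp only [Function.comp]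
  rw [slope_def_field, hA1, Real.log_one, sub_zero, Real.rpow_def_of_pos hAp]
  congr 1
  rw [← neg_sub α 1, inv_neg]
  ring

lemma heatP_bdd {f : ℝ → ℝ} (hfi : Integrable f) (hf0 : ∀ x, 0 ≤ f x) (hf1 : (∫ x : ℝ, f x) = 1)
    {s : ℝ} (hs : 0 < s) (x : ℝ) : heatP f s x ≤ (Real.sqrt (2 * Real.pi * s))⁻¹ := by
  rw [heatP_eq']
  calc ∫ y, f y * KK s (x - y) ≤ ∫ y, f y * (Real.sqrt (2 * Real.pi * s))⁻¹ := by
        refine integral_mono (KKint hfi hs x) (hfi.mul_const _) fun y => ?_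
        exact mul_le_mul_of_nonneg_left (KK_bdd _ hs) (hf0 y)
    _ = _ := by rw [integral_mul_const, hf1, one_mul]

lemma finish {g : ℝ → ℝ} {g0 : ℝ} (hg : ConcaveOn ℝ (Set.Ioc 0 1) g)
    (h0 : ∀ s ∈ Set.Ioc (0:ℝ) 1, g0 ≤ g s) {t : ℝ} (ht0 : 0 < t) (ht1 : t ≤ 1) :
    (1 - t) * g0 + t * g 1 ≤ g t := by
  rcases ht1.eq_or_lt with rfl | ht1
  · simp
  have hlim : Tendsto (fun s : ℝ => (1 - t) / (1 - s) * g0 + (t - s) / (1 - s) * g 1)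
      (nhdsWithin 0 (Set.Ioi 0)) (nhds ((1 - t) * g0 + t * g 1)) := by
    have hc : ContinuousAt (fun s : ℝ => (1 - t) / (1 - s) * g0 + (t - s) / (1 - s) * g 1) 0 := by
      have : (1 - (0:ℝ)) ≠ 0 := by norm_num
      fun_prop (disch := assumption)
    have := hc.tendsto
    simp only [sub_zero, div_one] at this
    exact this.mono_left nhdsWithin_le_nhds
  refine le_of_tendsto hlim ?_
  filter_upwards [Ioo_mem_nhdsGT ht0] with s hs
  have hs1 : 0 < 1 - s := by linarith [hs.2]
  have ha : 0 ≤ (1 - t) / (1 - s) := div_nonneg (by linarith) hs1.le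
  have h := hg.2 (show s ∈ Set.Ioc (0:ℝ) 1 from ⟨hs.1, by linarith [hs.2]⟩)
    (show (1:ℝ) ∈ Set.Ioc (0:ℝ) 1 from ⟨one_pos, le_rfl⟩) ha
    (show 0 ≤ (t - s) / (1 - s) from div_nonneg (by linarith [hs.2]) hs1.le) (by field_simp; ring)
  have e : (1 - t) / (1 - s) * s + (t - s) / (1 - s) * 1 = t := by field_simp; ring
  simp only [smul_eq_mul] at h
  rw [e] at h
  have := mul_le_mul_of_nonneg_left (h0 s ⟨hs.1, by linarith [hs.2]⟩) ha
  linarith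

/-- A Rényi entropy power inequality in Costa's sense:
exp(h_α(X + √t Z)) ≥ (1-t)·exp(h_α(X)) + t·exp(h_α(X + Z)) for t ∈ [0,1],
when 0 < α ≤ 3/2 + √2. -/
theorem renyi_costa_EPI_sqrt
    (f : ℝ → ℝ) (hfm : Measurable f) (hf0 : ∀ x, 0 ≤ f x)
    (hf1 : (∫ x : ℝ, f x) = 1)
    (α : ℝ) (hαl : 0 < α) (hαu : α ≤ 3 / 2 + Real.sqrt 2)
    (hfin : ∀ s ∈ Set.Icc (0 : ℝ) 1, renyiFinite0 f α s) :
    ∀ t ∈ Set.Icc (0 : ℝ) 1,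
      (1 - t) * Real.exp (renyiEnt0 f α 0) + t * Real.exp (renyiEnt0 f α 1)
        ≤ Real.exp (renyiEnt0 f α t) := by
  have hfi : Integrable f := by
    by_contra h
    rw [integral_undef h] at hf1
    norm_num at hf1
  rintro t ⟨ht0, ht1⟩
  rcases ht0.eq_or_lt with rfl | ht0
  · simp
  have hP0 : heatP0 f 0 = f := by ext x; simp [heatP0]
  have hPs : ∀ s : ℝ, 0 < s → heatP0 f s = heatP f s := fun s hs => by ext x; simp [heatP0, hs.ne']
  by_cases hα1 : α = 1
  · subst hα1
    have hl0 : Integrable (fun x => f x * Real.log (f x)) := by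
      have := hfin 0 ⟨le_rfl, zero_le_one⟩
      simpa [renyiFinite0, hP0] using this
    have hls : ∀ s ∈ Set.Ioc (0:ℝ) 1, Integrable (fun x => heatP f s x * Real.log (heatP f s x)) := by
      intro s hs
      have := hfin s ⟨hs.1.le, hs.2⟩
      simpa [renyiFinite0, hPs s hs.1] using this
    have hlim : ∀ s ∈ Set.Ioc (0:ℝ) 1, Tendsto (fun α : ℝ => (∫ x, heatP f s x ^ α) ^ (1 - α)⁻¹)
        (nhdsWithin 1 (Set.Ioi 1)) (nhds (Real.exp (renyiEnt0 f 1 s))) := by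
      intro s hs
      have hpi : Integrable (heatP f s) := conv_int hfi hs.1
      have h := renyi_limit (heatP_pos hfi hf0 hf1 hs.1) (heatP_cont hfi hs.1).measurable hpi
        ((conv_integral hfi hs.1).trans hf1) (heatP_bdd hfi hf0 hf1 hs.1) (hls s hs)
      simpa [renyiEnt0, hPs s hs.1] using h
    refine finish (g := fun s => Real.exp (renyiEnt0 f 1 s)) ?_ ?_ ht0 ht1
    · refine ⟨convex_Ioc 0 1, ?_⟩
      intro x hx y hy a b ha hb hab
      refine le_of_tendsto_of_tendsto
        (((hlim x hx).const_smul a).add ((hlim y hy).const_smul b))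
        (hlim _ (convex_Ioc 0 1 hx hy ha hb hab)) ?_
      have hIoo : Set.Ioo (1:ℝ) 2 ∈ nhdsWithin (1:ℝ) (Set.Ioi 1) := Ioo_mem_nhdsGT (by norm_num)
      filter_upwards [hIoo] with α hα
      have hα0 : 0 < α := by linarith [hα.1]
      have h2 : (1:ℝ) ≤ Real.sqrt 2 := by
        rw [Real.one_le_sqrt]; norm_num
      have hp1i : Integrable (heatP f 1) := conv_int hfi one_pos
      have hI : Integrable (fun x => heatP f 1 x ^ α) := by
        set B := (Real.sqrt (2 * Real.pi * 1))⁻¹ with hB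
        refine (hp1i.const_mul (B ^ (α - 1))).mono' (pa_meas hfi α one_pos).aestronglyMeasurable
          (Eventually.of_forall fun x => ?_)
        have hp := heatP_pos hfi hf0 hf1 one_pos x
        rw [Real.norm_eq_abs, abs_of_pos (Real.rpow_pos_of_pos hp α)]
        have e : heatP f 1 x ^ α = heatP f 1 x ^ (α - 1) * heatP f 1 x := by
          rw [← Real.rpow_add_one hp.ne']; congr 1; ring
        rw [e]
        have := Real.rpow_le_rpow hp.le (heatP_bdd hfi hf0 hf1 one_pos x) (by linarith [hα.1] : 0 ≤ α - 1)
        gcongr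
      exact (concave_A hfi hf0 hf1 hα0 (by linarith [hα.2]) (by linarith [hα.1] : 1 < α).ne' hI).2
        hx hy ha hb hab
    · intro s hs
      have := jensen_flow hfi hf0 Real.convexOn_mul_log Real.continuous_mul_log.continuousOn hl0 hs.1 (hls s hs)
      apply Real.exp_le_exp.2
      simp only [renyiEnt0, hP0, hPs s hs.1, if_true]
      linarith
  · have hl0 : Integrable (fun x => f x ^ α) ∧ 0 < ∫ x, f x ^ α := by
      have := hfin 0 ⟨le_rfl, zero_le_one⟩
      simpa [renyiFinite0, hP0, hα1] using this
    have hls : ∀ s ∈ Set.Ioc (0:ℝ) 1, Integrable (fun x => heatP f s x ^ α) ∧ 0 < ∫ x, heatP f s x ^ α := by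
      intro s hs
      have := hfin s ⟨hs.1.le, hs.2⟩
      simpa [renyiFinite0, hPs s hs.1, hα1] using this
    refine finish (g := fun s => Real.exp (renyiEnt0 f α s)) ?_ ?_ ht0 ht1
    · refine (concave_A hfi hf0 hf1 hαl hαu hα1 (hls 1 ⟨one_pos, le_rfl⟩).1).congr ?_
      intro s hs
      simp only [renyiEnt0, hPs s hs.1, hα1, if_false]
      rw [Real.rpow_def_of_pos (hls s hs).2, mul_comm]
    · intro s hs
      obtain ⟨hi, hpos⟩ := hls s hs
      apply Real.exp_le_exp.2
      simp only [renyiEnt0, hP0, hPs s hs.1, hα1, if_false]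
      rcases lt_or_gt_of_ne hα1 with h | h
      · have hc : ConvexOn ℝ (Set.Ici 0) (fun x : ℝ => -x ^ α) :=
          (Real.concaveOn_rpow hαl.le h.le).neg
        have := jensen_flow hfi hf0 hc (Real.continuous_rpow_const hαl.le).neg.continuousOn
          hl0.1.neg hs.1 hi.neg
        rw [integral_neg, integral_neg] at this
        have hlog := Real.log_le_log hl0.2 (neg_le_neg_iff.1 this)
        exact mul_le_mul_of_nonneg_left hlog (inv_nonneg.2 (by linarith))
      · have hc : ConvexOn ℝ (Set.Ici 0) (fun x : ℝ => x ^ α) := convexOn_rpow h.le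
        have := jensen_flow hfi hf0 hc (Real.continuous_rpow_const hαl.le).continuousOn
          hl0.1 hs.1 hi
        have hlog := Real.log_le_log hpos this
        exact mul_le_mul_of_nonpos_left hlog (inv_nonpos.2 (by linarith))
end

section
/- Let α ∈ (0, 1), and assume |h_α(p(·,s))| < ∞ for all s ∈ [0,1] (with p(·,0) = f, i.e. h_α(X) = h_α(f) is finite and t_α > 1). Then for every t ∈ [0,1], exp((α+1)·h_α(X + √t·Z)) ≥ (1−t)·exp((α+1)·h_α(X)) + t·exp((α+1)·h_α(X + Z)), where h_α(X + √t·Z) = h_α(p(·,t)). -/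
open MeasureTheory Real Filter
open scoped Classical

noncomputable def kH (k : ℕ) (t z : ℝ) : ℝ :=
  match k with
  | 0 => 1
  | 1 => -z / t
  | 2 => z ^ 2 / t ^ 2 - 1 / t
  | _ => -z ^ 3 / t ^ 3 + 3 * z / t ^ 2

noncomputable def kK (k : ℕ) (t z : ℝ) : ℝ :=
  kH k t z * ((Real.sqrt (2 * Real.pi * t))⁻¹ * Real.exp (-z ^ 2 / (2 * t)))

noncomputable def kP (f : ℝ → ℝ) (k : ℕ) (t x : ℝ) : ℝ :=
  ∫ y : ℝ, f y * kK k t (x - y)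

lemma hda {f g : ℝ → ℝ} {f' g' x : ℝ} (h : HasDerivAt g g' x) (hfg : ∀ y, f y = g y)
    (h' : f' = g') : HasDerivAt f f' x := by
  rw [h', show f = g from funext hfg]; exact h

lemma kK0_deriv_z (t z : ℝ) (ht : 0 < t) :
    HasDerivAt (fun z => (Real.sqrt (2 * Real.pi * t))⁻¹ * Real.exp (-z ^ 2 / (2 * t)))
      (-z / t * ((Real.sqrt (2 * Real.pi * t))⁻¹ * Real.exp (-z ^ 2 / (2 * t)))) z := by
  have h1 : HasDerivAt (fun z : ℝ => -z ^ 2 / (2 * t)) (-z / t) z := by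
    refine hda ((((hasDerivAt_id z).pow 2).neg).div_const (2 * t)) (fun y => by simp) ?_
    simp; field_simp
  exact hda (h1.exp.const_mul _) (fun y => rfl) (by ring)

lemma kK0_deriv_t (t z : ℝ) (ht : 0 < t) :
    HasDerivAt (fun t => (Real.sqrt (2 * Real.pi * t))⁻¹ * Real.exp (-z ^ 2 / (2 * t)))
      ((z ^ 2 / t ^ 2 - 1 / t) / 2 *
        ((Real.sqrt (2 * Real.pi * t))⁻¹ * Real.exp (-z ^ 2 / (2 * t)))) t := by
  have hp := Real.pi_pos
  have h1 : HasDerivAt (fun t : ℝ => -z ^ 2 / (2 * t)) (z ^ 2 / (2 * t ^ 2)) t := by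
    refine hda ((((hasDerivAt_id t).const_mul 2).inv (by simp; positivity)).const_mul (-z ^ 2))
      (fun y => by simp [div_eq_mul_inv]) ?_
    simp only [id]; field_simp
  have hs : 0 < Real.sqrt (2 * Real.pi * t) := by positivity
  have h2 : HasDerivAt (fun t : ℝ => (Real.sqrt (2 * Real.pi * t)))
      (Real.sqrt (2 * Real.pi * t) / (2 * t)) t := by
    refine hda (((hasDerivAt_id t).const_mul (2 * Real.pi)).sqrt (by simp; positivity))
      (fun y => by simp) ?_
    simp only [id]
    have hsq := Real.sq_sqrt (show 0 ≤ 2 * Real.pi * t by positivity)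
    generalize Real.sqrt (2 * Real.pi * t) = r at *
    field_simp
    linarith
  refine hda ((h2.inv hs.ne').mul h1.exp) (fun y => by simp) ?_
  simp only [Pi.inv_apply]
  generalize Real.sqrt (2 * Real.pi * t) = r at *
  field_simp
  ring

lemma kH_deriv_z (k : ℕ) (hk : k ≤ 2) (t z : ℝ) (ht : 0 < t) :
    HasDerivAt (fun z => kK k t z) (kK (k + 1) t z) z := by
  have h0 := kK0_deriv_z t z ht
  interval_cases k
  · refine hda h0 (fun y => by simp [kK, kH]) (by simp [kK, kH])
  · have h1 : HasDerivAt (fun z : ℝ => kH 1 t z) (-1 / t) z :=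
      ((hasDerivAt_id z).neg).div_const t
    refine hda (h1.mul h0) (fun y => by simp [kK]) ?_
    simp only [kK, kH]; field_simp; ring
  · have h1 : HasDerivAt (fun z : ℝ => kH 2 t z) (2 * z / t ^ 2) z := by
      refine hda ((((hasDerivAt_id z).pow 2).div_const (t ^ 2)).sub_const (1 / t))
        (fun y => by simp [kH]) ?_
      simp
    refine hda (h1.mul h0) (fun y => by simp [kK]) ?_
    simp only [kK, kH]; field_simp; ring

lemma kH_deriv_t (k : ℕ) (hk : k ≤ 1) (t z : ℝ) (ht : 0 < t) :
    HasDerivAt (fun t => kK k t z) (kK (k + 2) t z / 2) t := by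
  have h0 := kK0_deriv_t t z ht
  interval_cases k
  · refine hda h0 (fun y => by simp [kK, kH]) ?_
    simp only [kK, kH]; ring
  · have h1 : HasDerivAt (fun t : ℝ => kH 1 t z) (z / t ^ 2) t := by
      refine hda (((hasDerivAt_id t).inv ht.ne').const_mul (-z))
        (fun y => by simp [kH, div_eq_mul_inv]) ?_
      simp only [id]; field_simp
    refine hda (h1.mul h0) (fun y => by simp [kK]) ?_
    simp only [kK, kH]; field_simp; ring

lemma kK_cont (k : ℕ) : ContinuousOn (fun q : ℝ × ℝ => kK k q.1 q.2) (Set.Ioi 0 ×ˢ Set.univ) := by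
  have hp := Real.pi_pos
  have hne : ∀ q ∈ (Set.Ioi 0 ×ˢ Set.univ : Set (ℝ × ℝ)), 0 < q.1 := fun q hq => hq.1
  have h1 : ContinuousOn (fun q : ℝ × ℝ => kH k q.1 q.2) (Set.Ioi 0 ×ˢ Set.univ) := by
    unfold kH
    split
    · fun_prop
    · exact ContinuousOn.div (by fun_prop) (by fun_prop) (fun q hq => (hne q hq).ne')
    · exact (ContinuousOn.div (by fun_prop) (by fun_prop) (fun q hq => by have := hne q hq; positivity)).sub
        (ContinuousOn.div (by fun_prop) (by fun_prop) (fun q hq => (hne q hq).ne'))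
    · exact (ContinuousOn.div (by fun_prop) (by fun_prop) (fun q hq => by have := hne q hq; positivity)).add
        (ContinuousOn.div (by fun_prop) (by fun_prop) (fun q hq => by have := hne q hq; positivity))
  refine h1.mul (ContinuousOn.mul ?_ ?_)
  · exact ContinuousOn.inv₀ (by fun_prop) (fun q hq => by have := hne q hq; positivity)
  · exact (ContinuousOn.div (by fun_prop) (by fun_prop) (fun q hq => by have := hne q hq; positivity)).rexp

lemma kK_cont1 (k : ℕ) (t : ℝ) (ht : 0 < t) : Continuous (fun z => kK k t z) := by
  have := (kK_cont k).comp (f := fun z : ℝ => (t, z)) (s := Set.univ) (by fun_prop) (by intro z _; simp [ht])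
  simpa [continuousOn_univ, Function.comp_def] using this

lemma diff_under (f : ℝ → ℝ) (hf : Integrable f) (R : ℝ) (hR : ∀ y, y ∉ Set.Icc (-R) R → f y = 0)
    (G G' : ℝ → ℝ → ℝ) (s₀ δ : ℝ) (hδ : 0 < δ)
    (hd : ∀ s ∈ Metric.closedBall s₀ δ, ∀ y, HasDerivAt (fun s => G s y) (G' s y) s)
    (hc : ∀ s ∈ Metric.closedBall s₀ δ, Continuous (G s))
    (hc' : ContinuousOn (fun q : ℝ × ℝ => G' q.1 q.2) (Metric.closedBall s₀ δ ×ˢ Set.univ)) :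
    HasDerivAt (fun s => ∫ y, f y * G s y) (∫ y, f y * G' s₀ y) s₀ := by
  have hs0 : s₀ ∈ Metric.closedBall s₀ δ := Metric.mem_closedBall_self hδ.le
  have hK : IsCompact (Metric.closedBall s₀ δ ×ˢ Set.Icc (-R) R) :=
    (isCompact_closedBall s₀ δ).prod isCompact_Icc
  obtain ⟨C, hC⟩ := hK.exists_bound_of_continuousOn
    (hc'.mono (Set.prod_mono le_rfl (Set.subset_univ _)))
  obtain ⟨C0, hC0⟩ := (isCompact_Icc (a := -R) (b := R)).exists_bound_of_continuousOn
    (hc s₀ hs0).continuousOn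
  have hG' : Continuous (G' s₀) := by
    have := hc'.comp (f := fun z : ℝ => (s₀, z)) (s := Set.univ) (by fun_prop)
      (by intro z _; exact ⟨hs0, trivial⟩)
    simpa [continuousOn_univ, Function.comp_def] using this
  refine (hasDerivAt_integral_of_dominated_loc_of_deriv_le
    (F := fun s y => f y * G s y) (F' := fun s y => f y * G' s y)
    (bound := fun y => ‖f y‖ * C) (Metric.ball_mem_nhds s₀ hδ) ?_ ?_ ?_ ?_ ?_ ?_).2
  · filter_upwards [Metric.closedBall_mem_nhds s₀ hδ] with s hs
    exact hf.aestronglyMeasurable.mul (hc s hs).aestronglyMeasurable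
  · refine (hf.norm.mul_const C0).mono' (hf.aestronglyMeasurable.mul (hc s₀ hs0).aestronglyMeasurable) ?_
    filter_upwards with y
    by_cases hy : y ∈ Set.Icc (-R) R
    · rw [norm_mul]; gcongr; exact hC0 y hy
    · simp [hR y hy]
  · exact hf.aestronglyMeasurable.mul hG'.aestronglyMeasurable
  · filter_upwards with y s hs
    by_cases hy : y ∈ Set.Icc (-R) R
    · rw [norm_mul]; gcongr; exact hC (s, y) ⟨Metric.ball_subset_closedBall hs, hy⟩
    · simp [hR y hy]
  · exact hf.norm.mul_const C
  · filter_upwards with y s hs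
    exact (hd s (Metric.ball_subset_closedBall hs) y).const_mul _

lemma kP_deriv_x (f : ℝ → ℝ) (hf : Integrable f) (R : ℝ) (hR : ∀ y, y ∉ Set.Icc (-R) R → f y = 0)
    (k : ℕ) (hk : k ≤ 2) (t x : ℝ) (ht : 0 < t) :
    HasDerivAt (fun x => kP f k t x) (kP f (k + 1) t x) x := by
  refine diff_under f hf R hR (fun s y => kK k t (s - y)) (fun s y => kK (k + 1) t (s - y)) x 1
    one_pos ?_ ?_ ?_
  · intro s _ y
    exact (kH_deriv_z k hk t (s - y) ht).comp_sub_const s y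
  · intro s _
    exact (kK_cont1 k t ht).comp (by fun_prop)
  · exact ((kK_cont1 (k + 1) t ht).comp (f := fun q : ℝ × ℝ => q.1 - q.2) (by fun_prop)).continuousOn

lemma kP_deriv_t (f : ℝ → ℝ) (hf : Integrable f) (R : ℝ) (hR : ∀ y, y ∉ Set.Icc (-R) R → f y = 0)
    (k : ℕ) (hk : k ≤ 1) (t x : ℝ) (ht : 0 < t) :
    HasDerivAt (fun t => kP f k t x) (kP f (k + 2) t x / 2) t := by
  have hpos : ∀ s ∈ Metric.closedBall t (t / 2), 0 < s := by
    intro s hs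
    rw [Metric.mem_closedBall, Real.dist_eq, abs_le] at hs
    linarith
  have := diff_under f hf R hR (fun s y => kK k s (x - y)) (fun s y => kK (k + 2) s (x - y) / 2) t
    (t / 2) (by positivity) ?_ ?_ ?_
  · refine hda this (fun y => rfl) ?_
    rw [kP, ← integral_div]
    simp only [mul_div_assoc]
  · intro s hs y
    exact kH_deriv_t k hk s (x - y) (hpos s hs)
  · intro s hs
    exact (kK_cont1 k s (hpos s hs)).comp (by fun_prop)
  · refine ContinuousOn.div_const ?_ 2
    exact (kK_cont (k + 2)).comp (f := fun q : ℝ × ℝ => (q.1, x - q.2)) (by fun_prop)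
      (fun q hq => ⟨hpos _ hq.1, trivial⟩)

lemma kP_cont3 (f : ℝ → ℝ) (hf : Integrable f) (R : ℝ) (hR : ∀ y, y ∉ Set.Icc (-R) R → f y = 0)
    (k : ℕ) (t : ℝ) (ht : 0 < t) : Continuous (fun x => kP f k t x) := by
  rw [continuous_iff_continuousAt]
  intro x
  obtain ⟨C, hC⟩ := ((isCompact_closedBall x 1).prod (isCompact_Icc (a := -R) (b := R))).exists_bound_of_continuousOn
    (f := fun q : ℝ × ℝ => kK k t (q.1 - q.2))
    ((kK_cont1 k t ht).comp (f := fun q : ℝ × ℝ => q.1 - q.2) (by fun_prop)).continuousOn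
  refine continuousAt_of_dominated (bound := fun y => ‖f y‖ * C) ?_ ?_ (hf.norm.mul_const C) ?_
  · filter_upwards with s
    exact hf.aestronglyMeasurable.mul ((kK_cont1 k t ht).comp (by fun_prop)).aestronglyMeasurable
  · filter_upwards [Metric.closedBall_mem_nhds x one_pos] with s hs
    filter_upwards with y
    by_cases hy : y ∈ Set.Icc (-R) R
    · rw [norm_mul]; gcongr; exact hC (s, y) ⟨hs, hy⟩
    · simp [hR y hy]
  · filter_upwards with y
    exact (continuous_const.mul ((kK_cont1 k t ht).comp (by fun_prop))).continuousAt

lemma kP_int (f : ℝ → ℝ) (hf : Integrable f) (R : ℝ) (hR : ∀ y, y ∉ Set.Icc (-R) R → f y = 0)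
    (k : ℕ) (t x : ℝ) (ht : 0 < t) : Integrable (fun y => f y * kK k t (x - y)) := by
  have hc : Continuous (fun y => kK k t (x - y)) := (kK_cont1 k t ht).comp (by fun_prop)
  obtain ⟨C0, hC0⟩ := (isCompact_Icc (a := -R) (b := R)).exists_bound_of_continuousOn
    hc.continuousOn
  refine (hf.norm.mul_const C0).mono' (hf.aestronglyMeasurable.mul hc.aestronglyMeasurable) ?_
  filter_upwards with y
  by_cases hy : y ∈ Set.Icc (-R) R
  · rw [norm_mul]; gcongr; exact hC0 y hy
  · simp [hR y hy]

lemma kH_bound (l : ℝ) (hl : 0 < l) : ∃ M : ℝ, 0 ≤ M ∧ ∀ s, l ≤ s → ∀ k, ∀ z,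
    |kH k s z| ≤ M * (1 + z ^ 4) := by
  refine ⟨1 + l⁻¹ + 4 * l⁻¹ ^ 2 + l⁻¹ ^ 3, by positivity, ?_⟩
  intro s hs k z
  have hs0 : 0 < s := hl.trans_le hs
  have hi : s⁻¹ ≤ l⁻¹ := inv_anti₀ hl hs
  have hi0 : 0 < s⁻¹ := inv_pos.2 hs0
  have hli0 : 0 < l⁻¹ := inv_pos.2 hl
  have hi2 : s⁻¹ ^ 2 ≤ l⁻¹ ^ 2 := by gcongr
  have hi3 : s⁻¹ ^ 3 ≤ l⁻¹ ^ 3 := by gcongr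
  have z1 : |z| ≤ 1 + z ^ 4 := by
    rw [abs_le]; constructor <;> nlinarith [sq_nonneg (z ^ 2 - 1), sq_nonneg (z - 1), sq_nonneg (z + 1), sq_nonneg (z^2)]
  have z2 : |z| ^ 2 ≤ 1 + z ^ 4 := by
    rw [sq_abs]; nlinarith [sq_nonneg (z ^ 2 - 1), sq_nonneg (z^2)]
  have z3 : |z| ^ 3 ≤ 1 + z ^ 4 := by
    have h4 : z ^ 4 = |z| ^ 4 := by rw [show (4:ℕ) = 2 * 2 from rfl, pow_mul, pow_mul, sq_abs]
    rw [h4]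
    have := abs_nonneg z
    generalize |z| = a at *
    rcases le_total a 1 with h | h
    · nlinarith [pow_le_one₀ this h (n := 3), pow_nonneg this 4]
    · nlinarith [pow_nonneg this 3]
  have hz0 : 0 ≤ z ^ 4 := by positivity
  generalize hZ : 1 + z ^ 4 = Z at *
  have hZ1 : 1 ≤ Z := by linarith
  have n1 := abs_nonneg z
  generalize hκ : s⁻¹ = κ at *
  generalize l⁻¹ = m at *
  have a1 : |z| * κ ≤ Z * m := by gcongr
  have a2 : |z| ^ 2 * κ ^ 2 ≤ Z * m ^ 2 := by gcongr
  have a3 : |z| ^ 3 * κ ^ 3 ≤ Z * m ^ 3 := by gcongr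
  have a4 : |z| * κ ^ 2 ≤ Z * m ^ 2 := by gcongr
  have a5 : 1 * κ ≤ Z * m := by gcongr
  have p1 : 0 ≤ Z * m := by positivity
  have p2 : 0 ≤ Z * m ^ 2 := by positivity
  have p3 : 0 ≤ Z * m ^ 3 := by positivity
  unfold kH
  split
  · rw [abs_one]; nlinarith
  · rw [div_eq_mul_inv, hκ, abs_mul, abs_neg, abs_of_pos hi0]; nlinarith
  · rw [div_eq_mul_inv, div_eq_mul_inv, ← inv_pow, hκ]
    refine (abs_sub _ _).trans ?_
    rw [abs_mul, abs_pow, abs_pow, one_mul, abs_of_pos hi0]; nlinarith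
  · rw [div_eq_mul_inv, div_eq_mul_inv, ← inv_pow, ← inv_pow, hκ]
    refine (abs_add_le _ _).trans ?_
    rw [abs_mul, abs_mul, abs_neg, abs_mul, abs_pow, abs_pow, abs_pow, abs_of_pos hi0, abs_of_pos (by norm_num : (0:ℝ) < 3)]
    nlinarith

lemma kK_zero_pos (t z : ℝ) (ht : 0 < t) : 0 < kK 0 t z := by
  have hp := Real.pi_pos
  simp only [kK, kH]
  positivity

lemma kK_eq (k : ℕ) (t z : ℝ) : kK k t z = kH k t z * kK 0 t z := by
  simp [kK, kH]

lemma kP_pos (f : ℝ → ℝ) (hf : Integrable f) (hf0 : ∀ x, 0 ≤ f x) (hpos : 0 < ∫ x, f x)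
    (R : ℝ) (hR : ∀ y, y ∉ Set.Icc (-R) R → f y = 0)
    (t x : ℝ) (ht : 0 < t) : 0 < kP f 0 t x := by
  unfold kP
  rw [integral_pos_iff_support_of_nonneg
    (fun y => mul_nonneg (hf0 y) (kK_zero_pos _ _ ht).le) (kP_int f hf R hR 0 t x ht)]
  rw [integral_pos_iff_support_of_nonneg hf0 hf] at hpos
  convert hpos using 2
  ext y
  simp [(kK_zero_pos t (x - y) ht).ne']

lemma kP_bounds (f : ℝ → ℝ) (hf : Integrable f) (hf0 : ∀ x, 0 ≤ f x)
    (R : ℝ) (hR : ∀ y, y ∉ Set.Icc (-R) R → f y = 0) (l u α : ℝ) (hl : 0 < l) (hlu : l ≤ u)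
    (hα : 0 < α) :
    ∃ E B : ℝ → ℝ, (∀ x, 1 ≤ E x) ∧ Integrable B ∧
      ∀ s ∈ Set.Icc l u, ∀ x, (∀ k, |kP f k s x| ≤ E x * kP f 0 s x) ∧
        kP f 0 s x ^ α * E x ^ 4 ≤ B x := by
  obtain ⟨M, hM0, hM⟩ := kH_bound l hl
  have hu : 0 < u := hl.trans_le hlu
  have hpi := Real.pi_pos
  obtain ⟨a, ha, ha'⟩ : ∃ a : ℝ, 0 < a ∧ 8 * a = α / (8 * u) := ⟨α / (64 * u), by positivity, by field_simp; norm_num⟩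
  set A := 1 + M * (1 + 2 / a ^ 2) * Real.exp (2 * a * R ^ 2) with hA
  have hA1 : 1 ≤ A := by rw [hA]; have : 0 ≤ M * (1 + 2 / a ^ 2) * Real.exp (2 * a * R ^ 2) := by positivity
                         linarith
  set C := (∫ y, f y) * ((Real.sqrt (2 * Real.pi * l))⁻¹ * Real.exp (R ^ 2 / (2 * l))) with hC
  have hC0 : 0 ≤ C := mul_nonneg (integral_nonneg hf0) (by positivity)
  have hsq : ∀ y ∈ Set.Icc (-R) R, y ^ 2 ≤ R ^ 2 := fun y hy => by
    nlinarith [hy.1, hy.2]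
  refine ⟨fun x => A * Real.exp (2 * a * x ^ 2),
    fun x => C ^ α * A ^ 4 * Real.exp (-(α / (8 * u)) * x ^ 2), ?_, ?_, ?_⟩
  · intro x
    have : 1 ≤ Real.exp (2 * a * x ^ 2) := Real.one_le_exp (by positivity)
    nlinarith
  · exact (integrable_exp_neg_mul_sq (by positivity)).const_mul _
  intro s hs x
  have hs0 : 0 < s := hl.trans_le hs.1
  have hP0 : 0 ≤ kP f 0 s x :=
    integral_nonneg (fun y => mul_nonneg (hf0 y) (kK_zero_pos _ _ hs0).le)
  constructor
  · intro k
    unfold kP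
    rw [← integral_const_mul]
    refine (abs_integral_le_integral_abs).trans ?_
    refine integral_mono (kP_int f hf R hR k s x hs0).abs ((kP_int f hf R hR 0 s x hs0).const_mul _) ?_
    intro y
    simp only
    by_cases hy : y ∈ Set.Icc (-R) R
    · rw [kK_eq, abs_mul, abs_mul, abs_of_nonneg (hf0 y), abs_of_pos (kK_zero_pos _ _ hs0)]
      have hk := hM s hs.1 k (x - y)
      have h4 : ∀ z : ℝ, 1 + z ^ 4 ≤ (1 + 2 / a ^ 2) * Real.exp (a * z ^ 2) := by
        intro z
        have h := Real.quadratic_le_exp_of_nonneg (show 0 ≤ a * z ^ 2 by positivity)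
        have h1 : 1 ≤ Real.exp (a * z ^ 2) := Real.one_le_exp (by positivity)
        have h2 : z ^ 4 ≤ 2 / a ^ 2 * Real.exp (a * z ^ 2) := by
          rw [div_mul_eq_mul_div, le_div_iff₀ (by positivity)]
          have : 0 ≤ a * z ^ 2 := by positivity
          nlinarith
        linarith
      have h5 : Real.exp (a * (x - y) ^ 2) ≤ Real.exp (2 * a * R ^ 2) * Real.exp (2 * a * x ^ 2) := by
        rw [← Real.exp_add]
        apply Real.exp_le_exp.2
        have := hsq y hy
        nlinarith [mul_nonneg ha.le (sq_nonneg (x + y)), mul_le_mul_of_nonneg_left this ha.le]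
      have h6 : |kH k s (x - y)| ≤ A * Real.exp (2 * a * x ^ 2) := by
        calc _ ≤ M * (1 + (x - y) ^ 4) := hk
          _ ≤ M * ((1 + 2 / a ^ 2) * (Real.exp (2 * a * R ^ 2) * Real.exp (2 * a * x ^ 2))) := by
            gcongr
            exact (h4 _).trans (by gcongr)
          _ = (M * (1 + 2 / a ^ 2) * Real.exp (2 * a * R ^ 2)) * Real.exp (2 * a * x ^ 2) := by ring
          _ ≤ _ := by gcongr; rw [hA]; linarith
      have h7 := kK_zero_pos s (x - y) hs0
      have h8 := hf0 y
      calc _ ≤ f y * (A * Real.exp (2 * a * x ^ 2) * kK 0 s (x - y)) := by gcongr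
        _ = _ := by ring
    · simp [hR y hy]
  · have h1 : kP f 0 s x ≤ C * Real.exp (-(x ^ 2) / (4 * u)) := by
      rw [hC, mul_assoc, ← integral_mul_const]
      refine integral_mono (kP_int f hf R hR 0 s x hs0) (hf.mul_const _) ?_
      intro y
      simp only
      by_cases hy : y ∈ Set.Icc (-R) R
      · refine mul_le_mul_of_nonneg_left ?_ (hf0 y)
        simp only [kK, kH, one_mul]
        rw [mul_assoc _ (Real.exp _) (Real.exp _), ← Real.exp_add]
        have e1 : -(x - y) ^ 2 / (2 * s) ≤ R ^ 2 / (2 * l) + -(x ^ 2) / (4 * u) := by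
          have i1 : y ^ 2 / (2 * s) ≤ R ^ 2 / (2 * l) := by
            have := hsq y hy
            have := hs.1
            gcongr
          have i2 : x ^ 2 / (4 * u) ≤ x ^ 2 / (4 * s) := by
            have := hs.2
            gcongr
          have i3 : -(x - y) ^ 2 / (2 * s) ≤ y ^ 2 / (2 * s) - x ^ 2 / (4 * s) := by
            rw [← sub_nonneg]
            have : y ^ 2 / (2 * s) - x ^ 2 / (4 * s) - -(x - y) ^ 2 / (2 * s) = (x - 2 * y) ^ 2 / (4 * s) := by
              field_simp; ring
            rw [this]; positivity
          rw [neg_div (4 * u)]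
          linarith
        have := hs.1
        gcongr
      · simp [hR y hy]
    calc _ ≤ (C * Real.exp (-(x ^ 2) / (4 * u))) ^ α * (A * Real.exp (2 * a * x ^ 2)) ^ 4 := by
            gcongr
      _ = _ := by
        beta_reduce
        rw [Real.mul_rpow hC0 (Real.exp_pos _).le, ← Real.exp_mul, mul_pow, ← Real.exp_nat_mul,
          show -(α / (8 * u)) * x ^ 2 = -(x ^ 2) / (4 * u) * α + ((4 : ℕ) : ℝ) * (2 * a * x ^ 2) by
            push_cast
            rw [show (4:ℝ) * (2 * a * x ^ 2) = (8 * a) * x ^ 2 by ring, ha']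
            field_simp; ring, Real.exp_add]
        ring

lemma kP_key (f : ℝ → ℝ) (hf : Integrable f) (hf0 : ∀ x, 0 ≤ f x) (hpos : 0 < ∫ x, f x)
    (R : ℝ) (hR : ∀ y, y ∉ Set.Icc (-R) R → f y = 0) (α : ℝ) (hα : 0 < α) (hα1 : α < 1)
    (t : ℝ) (ht : 0 < t) :
    0 < (∫ x, kP f 0 t x ^ α) ∧ 
    HasDerivAt (fun s => ∫ x, kP f 0 s x ^ α)
      (α * (1 - α) / 2 * ∫ x, kP f 0 t x ^ α * (kP f 1 t x / kP f 0 t x) ^ 2) t ∧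
    ∃ J' : ℝ, HasDerivAt (fun s => ∫ x, kP f 0 s x ^ α * (kP f 1 s x / kP f 0 s x) ^ 2) J' t ∧
      (∫ x, kP f 0 t x ^ α) * J'
        + α ^ 2 * (∫ x, kP f 0 t x ^ α * (kP f 1 t x / kP f 0 t x) ^ 2) ^ 2 ≤ 0 := by
  obtain ⟨E, B, hE, hB, hEB⟩ := kP_bounds f hf hf0 R hR (t / 2) (2 * t) α (by positivity)
    (by linarith) hα
  have htI : t ∈ Set.Icc (t / 2) (2 * t) := ⟨by linarith, by linarith⟩
  have hball : ∀ s ∈ Metric.ball t (t / 2), s ∈ Set.Icc (t / 2) (2 * t) := by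
    intro s hs
    rw [Metric.mem_ball, Real.dist_eq, abs_lt] at hs
    exact ⟨by linarith, by linarith⟩
  have hs0 : ∀ s ∈ Set.Icc (t / 2) (2 * t), 0 < s := fun s hs => lt_of_lt_of_le (by positivity) hs.1
  have hP : ∀ s ∈ Set.Icc (t / 2) (2 * t), ∀ x, 0 < kP f 0 s x := fun s hs x =>
    kP_pos f hf hf0 hpos R hR s x (hs0 s hs)
  set r : ℕ → ℝ → ℝ → ℝ := fun k s x => kP f k s x / kP f 0 s x with hr
  set w : ℝ → ℝ → ℝ := fun s x => kP f 0 s x ^ α with hw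
  have hw0 : ∀ s ∈ Set.Icc (t / 2) (2 * t), ∀ x, 0 < w s x := fun s hs x =>
    Real.rpow_pos_of_pos (hP s hs x) _
  have hrE : ∀ s ∈ Set.Icc (t / 2) (2 * t), ∀ x k, |r k s x| ≤ E x := by
    intro s hs x k
    rw [hr]
    simp only
    rw [abs_div, abs_of_pos (hP s hs x), div_le_iff₀ (hP s hs x)]
    exact (hEB s hs x).1 k
  have hwE : ∀ s ∈ Set.Icc (t / 2) (2 * t), ∀ x c q, 0 ≤ c → |q| ≤ c * E x ^ 4 →
      ‖w s x * q‖ ≤ c * B x := by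
    intro s hs x c q hc hq
    rw [Real.norm_eq_abs, abs_mul, abs_of_pos (hw0 s hs x)]
    calc _ ≤ w s x * (c * E x ^ 4) := by gcongr; exact (hw0 s hs x).le
      _ = c * (w s x * E x ^ 4) := by ring
      _ ≤ _ := by gcongr; exact (hEB s hs x).2
  have hwc : ∀ s ∈ Set.Icc (t / 2) (2 * t), Continuous (w s) := fun s hs =>
    (kP_cont3 f hf R hR 0 s (hs0 s hs)).rpow_const (fun x => Or.inl (hP s hs x).ne')
  have hrc : ∀ s ∈ Set.Icc (t / 2) (2 * t), ∀ k, Continuous (r k s) := fun s hs k =>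
    (kP_cont3 f hf R hR k s (hs0 s hs)).div (kP_cont3 f hf R hR 0 s (hs0 s hs)) (fun x => (hP s hs x).ne')
  have hint : ∀ (q : ℝ → ℝ), Continuous q → ∀ c, 0 ≤ c → (∀ x, |q x| ≤ c * E x ^ 4) →
      Integrable (fun x => w t x * q x) := by
    intro q hq c hc hqc
    refine (hB.const_mul c).mono' ((hwc t htI).mul hq).aestronglyMeasurable ?_
    filter_upwards with x
    exact hwE t htI x c _ hc (hqc x)
  -- derivatives
  have dxw : ∀ x, HasDerivAt (fun x => w t x) (α * w t x * r 1 t x) x := by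
    intro x
    refine hda ((kP_deriv_x f hf R hR 0 (by norm_num) t x ht).rpow_const (p := α) (Or.inl (hP t htI x).ne'))
      (fun y => rfl) ?_
    rw [Real.rpow_sub_one (hP t htI x).ne']
    simp only [hw, hr]; ring
  have dtw : ∀ s ∈ Set.Icc (t / 2) (2 * t), ∀ x,
      HasDerivAt (fun s => w s x) (w s x * (α / 2 * r 2 s x)) s := by
    intro s hs x
    refine hda ((kP_deriv_t f hf R hR 0 (by norm_num) s x (hs0 s hs)).rpow_const (p := α) (Or.inl (hP s hs x).ne'))
      (fun y => rfl) ?_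
    rw [Real.rpow_sub_one (hP s hs x).ne']
    simp only [hw, hr]; ring
  have dxr : ∀ k ≤ 2, ∀ x, HasDerivAt (fun x => r k t x) (r (k + 1) t x - r 1 t x * r k t x) x := by
    intro k hk x
    have hp := (hP t htI x).ne'
    refine hda ((kP_deriv_x f hf R hR k hk t x ht).div
      (kP_deriv_x f hf R hR 0 (by norm_num) t x ht) hp) (fun y => rfl) ?_
    simp only [hr]; field_simp
  have dtr : ∀ s ∈ Set.Icc (t / 2) (2 * t), ∀ x,
      HasDerivAt (fun s => r 1 s x) (r 3 s x / 2 - r 1 s x * r 2 s x / 2) s := by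
    intro s hs x
    have hp := (hP s hs x).ne'
    refine hda ((kP_deriv_t f hf R hR 1 le_rfl s x (hs0 s hs)).div
      (kP_deriv_t f hf R hR 0 (by norm_num) s x (hs0 s hs)) hp) (fun y => rfl) ?_
    simp only [hr]; field_simp
  -- monomial bounds
  have p2 : ∀ x, 1 ≤ E x ^ 4 := fun x => one_le_pow₀ (hE x)
  have e1 : ∀ x, E x ≤ E x ^ 4 := fun x => by simpa using pow_le_pow_right₀ (hE x) (show 1 ≤ 4 by norm_num)
  have e2 : ∀ x, E x ^ 2 ≤ E x ^ 4 := fun x => pow_le_pow_right₀ (hE x) (show 2 ≤ 4 by norm_num)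
  have e3 : ∀ x, E x ^ 3 ≤ E x ^ 4 := fun x => pow_le_pow_right₀ (hE x) (show 3 ≤ 4 by norm_num)
  have hE0 : ∀ x, 0 ≤ E x := fun x => zero_le_one.trans (hE x)
  have m2 : ∀ s ∈ Set.Icc (t / 2) (2 * t), ∀ x j k, |r j s x * r k s x| ≤ E x ^ 2 := by
    intro s hs x j k
    rw [abs_mul, sq]
    exact mul_le_mul (hrE s hs x j) (hrE s hs x k) (abs_nonneg _) (hE0 x)
  have m3 : ∀ s ∈ Set.Icc (t / 2) (2 * t), ∀ x k, |r 1 s x ^ 2 * r k s x| ≤ E x ^ 3 := by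
    intro s hs x k
    rw [abs_mul, sq, pow_succ]
    exact mul_le_mul (m2 s hs x 1 1) (hrE s hs x k) (abs_nonneg _) (by have := hE0 x; positivity)
  have i0 : Integrable (fun x => w t x) := by
    simpa using hint (fun _ => 1) continuous_const 1 zero_le_one (fun x => by simpa using p2 x)
  have c1 := hrc t htI 1
  have c2 := hrc t htI 2
  have c3 := hrc t htI 3
  have i1 : Integrable (fun x => w t x * r 1 t x) :=
    hint _ c1 1 zero_le_one (fun x => by rw [one_mul]; exact (hrE t htI x 1).trans (e1 x))
  have i2 : Integrable (fun x => w t x * r 2 t x) :=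
    hint _ c2 1 zero_le_one (fun x => by rw [one_mul]; exact (hrE t htI x 2).trans (e1 x))
  have i11 : Integrable (fun x => w t x * r 1 t x ^ 2) :=
    hint _ (c1.pow 2) 1 zero_le_one (fun x => by
      rw [one_mul, sq]; exact (m2 t htI x 1 1).trans (e2 x))
  have i12 : Integrable (fun x => w t x * (r 1 t x * r 2 t x)) :=
    hint _ (c1.mul c2) 1 zero_le_one (fun x => by
      rw [one_mul]; exact (m2 t htI x 1 2).trans (e2 x))
  have i13 : Integrable (fun x => w t x * (r 1 t x * r 3 t x)) :=
    hint _ (c1.mul c3) 1 zero_le_one (fun x => by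
      rw [one_mul]; exact (m2 t htI x 1 3).trans (e2 x))
  have i22 : Integrable (fun x => w t x * r 2 t x ^ 2) :=
    hint _ (c2.pow 2) 1 zero_le_one (fun x => by
      rw [one_mul, sq]; exact (m2 t htI x 2 2).trans (e2 x))
  have i111 : Integrable (fun x => w t x * r 1 t x ^ 3) :=
    hint _ (c1.pow 3) 1 zero_le_one (fun x => by
      rw [one_mul, pow_succ]; exact (m3 t htI x 1).trans (e3 x))
  have i112 : Integrable (fun x => w t x * (r 1 t x ^ 2 * r 2 t x)) :=
    hint _ ((c1.pow 2).mul c2) 1 zero_le_one (fun x => by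
      rw [one_mul]; exact (m3 t htI x 2).trans (e3 x))
  have i1111 : Integrable (fun x => w t x * r 1 t x ^ 4) :=
    hint _ (c1.pow 4) 1 zero_le_one (fun x => by
      rw [one_mul, abs_pow]; exact pow_le_pow_left₀ (abs_nonneg _) (hrE t htI x 1) 4)
  -- integrations by parts
  set J := ∫ x, w t x * r 1 t x ^ 2 with hJ
  set I := ∫ x, w t x with hI
  set D2 := ∫ x, w t x * r 2 t x with hD2
  set D13 := ∫ x, w t x * (r 1 t x * r 3 t x) with hD13
  set D22 := ∫ x, w t x * r 2 t x ^ 2 with hD22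
  set D112 := ∫ x, w t x * (r 1 t x ^ 2 * r 2 t x) with hD112
  set D4 := ∫ x, w t x * r 1 t x ^ 4 with hD4
  have ibp1 : D2 = (1 - α) * J := by
    have hI1 : Integrable (fun x => w t x * r 2 t x + (α - 1) * (w t x * r 1 t x ^ 2)) :=
      i2.add (i11.const_mul _)
    have := integral_eq_zero_of_hasDerivAt_of_integrable (f := fun x => w t x * r 1 t x)
      (f' := fun x => w t x * r 2 t x + (α - 1) * (w t x * r 1 t x ^ 2))
      (fun x => hda ((dxw x).mul (dxr 1 (by norm_num) x)) (fun y => rfl) (by ring)) hI1 i1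
    rw [integral_add i2 (i11.const_mul _), integral_const_mul] at this
    linarith
  have ibp2 : (α - 2) * D112 + D22 + D13 = 0 := by
    have hA : Integrable (fun x => (α - 2) * (w t x * (r 1 t x ^ 2 * r 2 t x))
        + w t x * r 2 t x ^ 2) := (i112.const_mul _).add i22
    have := integral_eq_zero_of_hasDerivAt_of_integrable (f := fun x => w t x * (r 1 t x * r 2 t x))
      (f' := fun x => (α - 2) * (w t x * (r 1 t x ^ 2 * r 2 t x)) + w t x * r 2 t x ^ 2
        + w t x * (r 1 t x * r 3 t x))
      (fun x => hda ((dxw x).mul ((dxr 1 (by norm_num) x).mul (dxr 2 (by norm_num) x)))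
        (fun y => rfl) (by simp only [Pi.mul_apply]; ring)) (hA.add i13) i12
    rw [integral_add hA i13, integral_add (i112.const_mul _) i22, integral_const_mul] at this
    linarith
  have ibp3 : 3 * D112 + (α - 3) * D4 = 0 := by
    have hA : Integrable (fun x => 3 * (w t x * (r 1 t x ^ 2 * r 2 t x))
        + (α - 3) * (w t x * r 1 t x ^ 4)) := (i112.const_mul _).add (i1111.const_mul _)
    have := integral_eq_zero_of_hasDerivAt_of_integrable (f := fun x => w t x * r 1 t x ^ 3)
      (f' := fun x => 3 * (w t x * (r 1 t x ^ 2 * r 2 t x)) + (α - 3) * (w t x * r 1 t x ^ 4))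
      (fun x => hda ((dxw x).mul ((dxr 1 (by norm_num) x).pow 3))
        (fun y => rfl) (by simp only [Pi.pow_apply]; push_cast; ring)) hA i111
    rw [integral_add (i112.const_mul _) (i1111.const_mul _), integral_const_mul,
      integral_const_mul] at this
    linarith
  have hIpos : 0 < I := by
    rw [hI, integral_pos_iff_support_of_nonneg (fun x => (hw0 t htI x).le) i0]
    have : Function.support (fun x => w t x) = Set.univ := by
      ext x; simp [(hw0 t htI x).ne']
    rw [this]; simp
  refine ⟨hIpos, ?_, ?_⟩
  · refine hda (hasDerivAt_integral_of_dominated_loc_of_deriv_le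
      (F := fun s x => w s x) (F' := fun s x => w s x * (α / 2 * r 2 s x))
      (bound := fun x => 1 * B x) (Metric.ball_mem_nhds t (by positivity : 0 < t / 2))
      ?_ i0 ?_ ?_ (hB.const_mul 1) ?_).2 (fun y => rfl) ?_
    · filter_upwards [Metric.ball_mem_nhds t (by positivity : 0 < t / 2)] with s hs
      exact (hwc s (hball s hs)).aestronglyMeasurable
    · exact ((hwc t htI).mul (continuous_const.mul c2)).aestronglyMeasurable
    · filter_upwards with x s hs
      refine hwE s (hball s hs) x 1 _ zero_le_one ?_
      rw [abs_mul, abs_of_pos (by positivity)]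
      have := hrE s (hball s hs) x 2
      have := abs_nonneg (r 2 s x)
      nlinarith [e1 x]
    · filter_upwards with x s hs
      exact dtw s (hball s hs) x
    · have : (∫ x, w t x * (α / 2 * r 2 t x)) = α / 2 * D2 := by
        rw [hD2, ← integral_const_mul]; congr 1; ext x; ring
      rw [this, ibp1]; ring
  · refine ⟨(α / 2 - 1) * D112 + D13, ?_, ?_⟩
    · refine hda (hasDerivAt_integral_of_dominated_loc_of_deriv_le
        (F := fun s x => w s x * r 1 s x ^ 2)
        (F' := fun s x => w s x * ((α / 2 - 1) * (r 1 s x ^ 2 * r 2 s x) + r 1 s x * r 3 s x))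
        (bound := fun x => 2 * B x) (Metric.ball_mem_nhds t (by positivity : 0 < t / 2))
        ?_ i11 ?_ ?_ (hB.const_mul 2) ?_).2 (fun y => rfl) ?_
      · filter_upwards [Metric.ball_mem_nhds t (by positivity : 0 < t / 2)] with s hs
        exact ((hwc s (hball s hs)).mul ((hrc s (hball s hs) 1).pow 2)).aestronglyMeasurable
      · exact ((hwc t htI).mul ((continuous_const.mul ((c1.pow 2).mul c2)).add
          (c1.mul c3))).aestronglyMeasurable
      · filter_upwards with x s hs
        refine hwE s (hball s hs) x 2 _ zero_le_two ?_
        refine (abs_add_le _ _).trans ?_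
        rw [abs_mul]
        have h1 := m3 s (hball s hs) x 2
        have h2 := m2 s (hball s hs) x 1 3
        have h3 : |α / 2 - 1| ≤ 1 := by rw [abs_le]; constructor <;> linarith
        have h4 := abs_nonneg (r 1 s x ^ 2 * r 2 s x)
        nlinarith [e3 x, e2 x]
      · filter_upwards with x s hs
        refine hda ((dtw s (hball s hs) x).mul ((dtr s (hball s hs) x).pow 2)) (fun y => rfl) ?_
        simp only [Pi.pow_apply]; push_cast; ring
      · rw [hD112, hD13, ← integral_const_mul, ← integral_add (i112.const_mul _) i13]
        congr 1; ext x; ring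
    · -- Cauchy-Schwarz
      have hcs : 0 ≤ ∫ x, w t x * (r 2 t x - r 1 t x ^ 2 + α * J / I) ^ 2 :=
        integral_nonneg (fun x => mul_nonneg (hw0 t htI x).le (sq_nonneg _))
      set c := α * J / I with hc
      have hexp : (∫ x, w t x * (r 2 t x - r 1 t x ^ 2 + c) ^ 2)
          = D22 - 2 * D112 + D4 + 2 * c * D2 - 2 * c * J + c ^ 2 * I := by
        have : (fun x => w t x * (r 2 t x - r 1 t x ^ 2 + c) ^ 2) = fun x =>
            (((((w t x * r 2 t x ^ 2 - 2 * (w t x * (r 1 t x ^ 2 * r 2 t x))) + w t x * r 1 t x ^ 4)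
            + 2 * c * (w t x * r 2 t x)) - 2 * c * (w t x * r 1 t x ^ 2)) + c ^ 2 * w t x) := by
          ext x; ring
        have a1 : Integrable (fun x => w t x * r 2 t x ^ 2
            - 2 * (w t x * (r 1 t x ^ 2 * r 2 t x))) := i22.sub (i112.const_mul 2)
        have a2 : Integrable (fun x => (w t x * r 2 t x ^ 2
            - 2 * (w t x * (r 1 t x ^ 2 * r 2 t x))) + w t x * r 1 t x ^ 4) := a1.add i1111
        have a3 : Integrable (fun x => ((w t x * r 2 t x ^ 2
            - 2 * (w t x * (r 1 t x ^ 2 * r 2 t x))) + w t x * r 1 t x ^ 4)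
            + 2 * c * (w t x * r 2 t x)) := a2.add (i2.const_mul (2 * c))
        have a4 : Integrable (fun x => (((w t x * r 2 t x ^ 2
            - 2 * (w t x * (r 1 t x ^ 2 * r 2 t x))) + w t x * r 1 t x ^ 4)
            + 2 * c * (w t x * r 2 t x)) - 2 * c * (w t x * r 1 t x ^ 2)) :=
          a3.sub (i11.const_mul (2 * c))
        rw [this, integral_add a4 (i0.const_mul (c ^ 2)), integral_sub a3 (i11.const_mul (2 * c)),
          integral_add a2 (i2.const_mul (2 * c)), integral_add a1 i1111,
          integral_sub i22 (i112.const_mul 2)]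
        simp only [integral_const_mul]
        rfl
      rw [hexp] at hcs
      have hD4 : 0 ≤ D4 := integral_nonneg (fun x => mul_nonneg (hw0 t htI x).le (by positivity))
      have hcI : c * I = α * J := by rw [hc]; field_simp
      have e13 : D13 = -(α - 2) * D112 - D22 := by linarith
      have e112 : D112 = (3 - α) / 3 * D4 := by linarith
      have key : D22 - 2 * D112 + D4 - c * (α * J) ≥ 0 := by
        rw [ibp1] at hcs
        have hcc : c ^ 2 * I = c * (α * J) := by rw [sq, mul_assoc, hcI]
        linarith
      have k2 : (α / 2 - 1) * D112 + D13 + c * (α * J) ≤ 0 := by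
        have : (α / 2 - 1) * D112 + D13 = -(D22 - 2 * D112 + D4) - α * (1 - α) / 6 * D4 := by
          rw [e13, e112]; ring
        have h5 : 0 ≤ α * (1 - α) / 6 * D4 :=
          mul_nonneg (div_nonneg (mul_nonneg hα.le (by linarith)) (by norm_num)) hD4
        linarith
      have : I * ((α / 2 - 1) * D112 + D13) + α ^ 2 * J ^ 2
          = I * ((α / 2 - 1) * D112 + D13 + c * (α * J)) := by
        linear_combination -(α * J) * hcI
      rw [this]
      exact mul_nonpos_of_nonneg_of_nonpos hIpos.le k2

lemma kP_concave (f : ℝ → ℝ) (hf : Integrable f) (hf0 : ∀ x, 0 ≤ f x) (hpos : 0 < ∫ x, f x)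
    (R : ℝ) (hR : ∀ y, y ∉ Set.Icc (-R) R → f y = 0) (α : ℝ) (hα : 0 < α) (hα1 : α < 1) :
    ConcaveOn ℝ (Set.Ioi (0 : ℝ)) (fun s => (∫ x, kP f 0 s x ^ α) ^ ((α + 1) / (1 - α))) := by
  have h1α : 0 < 1 - α := by linarith
  have key := fun t ht => kP_key f hf hf0 hpos R hR α hα hα1 t ht
  choose! hI hI' J' hJ' hle using key
  set m := (α + 1) / (1 - α) with hm
  set I : ℝ → ℝ := fun s => ∫ x, kP f 0 s x ^ α with hIdef
  set J : ℝ → ℝ := fun s => ∫ x, kP f 0 s x ^ α * (kP f 1 s x / kP f 0 s x) ^ 2 with hJdef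
  have hm1 : (m - 1) * (α * (1 - α) / 2) = α ^ 2 := by
    rw [hm]; field_simp; ring
  have hm0 : 0 < m := by rw [hm]; positivity
  refine concaveOn_of_hasDerivWithinAt2_nonpos (convex_Ioi 0)
    (f' := fun t => (m * (α * (1 - α) / 2)) * (I t ^ (m - 1) * J t))
    (f'' := fun t => (m * (α * (1 - α) / 2)) * (I t ^ (m - 2) * (I t * J' t + α ^ 2 * J t ^ 2)))
    ?_ ?_ ?_ ?_
  · intro t ht
    exact ((hI' t ht).rpow_const (p := m) (Or.inl (hI t ht).ne')).continuousAt.continuousWithinAt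
  · rw [interior_Ioi]
    intro t ht
    refine HasDerivAt.hasDerivWithinAt ?_
    refine hda ((hI' t ht).rpow_const (p := m) (Or.inl (hI t ht).ne')) (fun y => rfl) ?_
    simp only [hIdef, hJdef]; ring
  · rw [interior_Ioi]
    intro t ht
    refine HasDerivAt.hasDerivWithinAt ?_
    refine hda ((((hI' t ht).rpow_const (p := m - 1) (Or.inl (hI t ht).ne')).mul (hJ' t ht)).const_mul
      (m * (α * (1 - α) / 2))) (fun y => rfl) ?_
    have e1 : I t ^ (m - 1) = I t ^ (m - 2) * I t := by
      rw [← Real.rpow_add_one (hI t ht).ne']; congr 1; ring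
    change _ = m * (α * (1 - α) / 2) * (α * (1 - α) / 2 * J t * (m - 1) * I t ^ (m - 1 - 1) * J t
      + I t ^ (m - 1) * J' t)
    rw [e1, show m - 1 - 1 = m - 2 by ring, ← hm1]
    ring
  · rw [interior_Ioi]
    intro t ht
    have := hle t ht
    have h2 : 0 ≤ I t ^ (m - 2) := Real.rpow_nonneg (hI t ht).le _
    have h3 : 0 ≤ m * (α * (1 - α) / 2) := by positivity
    exact mul_nonpos_of_nonneg_of_nonpos h3 (mul_nonpos_of_nonneg_of_nonpos h2 this)

lemma kK0_eq (t z : ℝ) (ht : 0 < t) : kK 0 t z = ProbabilityTheory.gaussianPDFReal 0 ⟨t, ht.le⟩ z := by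
  simp [kK, kH, ProbabilityTheory.gaussianPDFReal]
  rfl

lemma kK0_int (t : ℝ) (ht : 0 < t) : Integrable (fun z => kK 0 t z) := by
  simp_rw [kK0_eq t _ ht]
  exact ProbabilityTheory.integrable_gaussianPDFReal _ _

lemma kK0_integral (t : ℝ) (ht : 0 < t) : ∫ z, kK 0 t z = 1 := by
  simp_rw [kK0_eq t _ ht]
  refine ProbabilityTheory.integral_gaussianPDFReal_eq_one _ ?_
  intro h
  exact ht.ne' (congrArg NNReal.toReal h)

lemma kP_int' (f : ℝ → ℝ) (hf : Integrable f) (t x : ℝ) (ht : 0 < t) :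
    Integrable (fun y => f y * kK 0 t (x - y)) := by
  refine (hf.norm.mul_const ((Real.sqrt (2 * Real.pi * t))⁻¹)).mono'
    (hf.aestronglyMeasurable.mul ((kK_cont1 0 t ht).comp (by fun_prop)).aestronglyMeasurable) ?_
  filter_upwards with y
  rw [norm_mul]
  gcongr
  rw [Real.norm_eq_abs, abs_of_pos (kK_zero_pos _ _ ht)]
  simp only [kK, kH, one_mul]
  refine mul_le_of_le_one_right (by positivity) (Real.exp_le_one_iff.2 ?_)
  rw [neg_div, neg_nonpos]; positivity

lemma kP_pos' (f : ℝ → ℝ) (hf : Integrable f) (hf0 : ∀ x, 0 ≤ f x) (hpos : 0 < ∫ x, f x)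
    (t x : ℝ) (ht : 0 < t) : 0 < kP f 0 t x := by
  unfold kP
  rw [integral_pos_iff_support_of_nonneg
    (fun y => mul_nonneg (hf0 y) (kK_zero_pos _ _ ht).le) (kP_int' f hf t x ht)]
  rw [integral_pos_iff_support_of_nonneg hf0 hf] at hpos
  convert hpos using 2
  ext y
  simp [(kK_zero_pos t (x - y) ht).ne']

lemma rpow_tangent (a c α : ℝ) (ha : 0 ≤ a) (hc : 0 < c) (hα : 0 < α) (hα1 : α < 1) :
    a ^ α ≤ c ^ α * (1 - α) + α * (c ^ α / c) * a := by
  have h := rpow_one_add_le_one_add_mul_self (s := a / c - 1) (p := α)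
    (by have : 0 ≤ a / c := by positivity
        linarith) hα.le hα1.le
  rw [add_sub_cancel, Real.div_rpow ha hc.le, div_le_iff₀ (by positivity)] at h
  refine h.trans (le_of_eq ?_)
  field_simp
  ring

lemma kP_jensen (f : ℝ → ℝ) (hf : Integrable f) (hf0 : ∀ x, 0 ≤ f x) (hpos : 0 < ∫ x, f x)
    (α : ℝ) (hα : 0 < α) (hα1 : α < 1) (t : ℝ) (ht : 0 < t)
    (h0 : Integrable (fun x => f x ^ α)) (h1 : Integrable (fun x => kP f 0 t x ^ α)) :
    ∫ x, f x ^ α ≤ ∫ x, kP f 0 t x ^ α := by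
  have hc := integral_convolution (ContinuousLinearMap.mul ℝ ℝ) h0 (kK0_int t ht)
  have hci := h0.integrable_convolution (ContinuousLinearMap.mul ℝ ℝ) (kK0_int t ht)
  rw [kK0_integral t ht] at hc
  simp only [ContinuousLinearMap.mul_apply', mul_one] at hc
  rw [← hc]
  refine integral_mono hci h1 ?_
  intro x
  simp only [convolution_def, ContinuousLinearMap.mul_apply']
  set c := kP f 0 t x with hcdef
  have hcpos : 0 < c := kP_pos' f hf hf0 hpos t x ht
  have iK : Integrable (fun y => kK 0 t (x - y)) := (kK0_int t ht).comp_sub_left x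
  have iKI : ∫ y, kK 0 t (x - y) = 1 := by
    rw [integral_sub_left_eq_self (fun y => kK 0 t y) volume x, kK0_integral t ht]
  have iA : Integrable (fun y => c ^ α * (1 - α) * kK 0 t (x - y)) := iK.const_mul _
  have iB : Integrable (fun y => α * (c ^ α / c) * (f y * kK 0 t (x - y))) :=
    (kP_int' f hf t x ht).const_mul _
  calc ∫ y, f y ^ α * kK 0 t (x - y)
      ≤ ∫ y, (c ^ α * (1 - α) * kK 0 t (x - y) + α * (c ^ α / c) * (f y * kK 0 t (x - y))) := by
        refine integral_mono (kP_int' _ h0 t x ht) (iA.add iB) ?_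
        intro y
        have := mul_le_mul_of_nonneg_right (rpow_tangent (f y) c α (hf0 y) hcpos hα hα1)
          (kK_zero_pos t (x - y) ht).le
        simp only
        linarith
    _ = c ^ α * (1 - α) + α * (c ^ α / c) * c := by
        rw [integral_add iA iB, integral_const_mul, integral_const_mul, iKI, mul_one]
        rfl
    _ = c ^ α := by field_simp; ring

lemma heatP_eq_kP (f : ℝ → ℝ) (t x : ℝ) : heatP f t x = kP f 0 t x := by
  simp [heatP, kP, kK, kH]

lemma kP_tendsto (f : ℝ → ℝ) (hf : Integrable f) (hfm : Measurable f) (hf0 : ∀ x, 0 ≤ f x)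
    (α : ℝ) (hα : 0 < α) (t : ℝ) (ht : 0 < t)
    (h1 : Integrable (fun x => kP f 0 t x ^ α)) :
    Tendsto (fun n : ℕ => ∫ x, kP ((Set.Icc (-(n : ℝ)) n).indicator f) 0 t x ^ α) atTop
      (nhds (∫ x, kP f 0 t x ^ α)) := by
  have hg0 : ∀ (n : ℕ) y, 0 ≤ (Set.Icc (-(n : ℝ)) n).indicator f y := fun n y =>
    Set.indicator_nonneg (fun y _ => hf0 y) y
  have hgle : ∀ (n : ℕ) y, (Set.Icc (-(n : ℝ)) n).indicator f y ≤ f y := fun n y =>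
    Set.indicator_le_self' (fun y _ => hf0 y) y
  have hgi : ∀ n : ℕ, Integrable ((Set.Icc (-(n : ℝ)) n).indicator f) := fun n =>
    hf.indicator measurableSet_Icc
  have hP0 : ∀ (n : ℕ) x, 0 ≤ kP ((Set.Icc (-(n : ℝ)) n).indicator f) 0 t x := fun n x =>
    integral_nonneg (fun y => mul_nonneg (hg0 n y) (kK_zero_pos _ _ ht).le)
  refine tendsto_integral_of_dominated_convergence (fun x => kP f 0 t x ^ α) ?_ h1 ?_ ?_
  · intro n
    have hc : Continuous (fun x => kP ((Set.Icc (-(n : ℝ)) n).indicator f) 0 t x) :=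
      kP_cont3 _ (hgi n) n (fun y hy => Set.indicator_of_notMem hy f) 0 t ht
    exact (hc.rpow_const (fun x => Or.inr hα.le)).aestronglyMeasurable
  · intro n
    filter_upwards with x
    rw [Real.norm_eq_abs, abs_of_nonneg (Real.rpow_nonneg (hP0 n x) _)]
    refine Real.rpow_le_rpow (hP0 n x) ?_ hα.le
    refine integral_mono (kP_int' _ (hgi n) t x ht) (kP_int' _ hf t x ht) ?_
    intro y
    exact mul_le_mul_of_nonneg_right (hgle n y) (kK_zero_pos _ _ ht).le
  · filter_upwards with x
    refine Tendsto.rpow_const ?_ (Or.inr hα.le)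
    refine tendsto_integral_of_dominated_convergence (fun y => f y * kK 0 t (x - y)) ?_
      (kP_int' _ hf t x ht) ?_ ?_
    · intro n
      exact (kP_int' _ (hgi n) t x ht).aestronglyMeasurable
    · intro n
      filter_upwards with y
      rw [Real.norm_eq_abs, abs_of_nonneg (mul_nonneg (hg0 n y) (kK_zero_pos _ _ ht).le)]
      exact mul_le_mul_of_nonneg_right (hgle n y) (kK_zero_pos _ _ ht).le
    · filter_upwards with y
      refine tendsto_const_nhds.congr' ?_
      filter_upwards [eventually_ge_atTop ⌈|y|⌉₊] with n hn
      have : |y| ≤ n := (Nat.le_ceil _).trans (by exact_mod_cast hn)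
      rw [Set.indicator_of_mem (show y ∈ Set.Icc (-(n : ℝ)) n from abs_le.1 this)]

lemma trunc_pos (f : ℝ → ℝ) (hf : Integrable f) (hf0 : ∀ x, 0 ≤ f x) (hpos : 0 < ∫ x, f x) :
    ∀ᶠ n : ℕ in atTop, 0 < ∫ x, (Set.Icc (-(n : ℝ)) n).indicator f x := by
  have : Tendsto (fun n : ℕ => ∫ x, (Set.Icc (-(n : ℝ)) n).indicator f x) atTop
      (nhds (∫ x, f x)) := by
    refine tendsto_integral_of_dominated_convergence f ?_ hf ?_ ?_
    · intro n
      exact (hf.indicator measurableSet_Icc).aestronglyMeasurable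
    · intro n
      filter_upwards with y
      rw [Real.norm_eq_abs, abs_of_nonneg (Set.indicator_nonneg (fun y _ => hf0 y) y)]
      exact Set.indicator_le_self' (fun y _ => hf0 y) y
    · filter_upwards with y
      refine tendsto_const_nhds.congr' ?_
      filter_upwards [eventually_ge_atTop ⌈|y|⌉₊] with n hn
      have : |y| ≤ n := (Nat.le_ceil _).trans (by exact_mod_cast hn)
      rw [Set.indicator_of_mem (show y ∈ Set.Icc (-(n : ℝ)) n from abs_le.1 this)]
  exact this.eventually (lt_mem_nhds hpos)

/-- A Rényi entropy power inequality in Costa's sense: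
exp((α+1)h_α(X + √t Z)) ≥ (1-t)·exp((α+1)h_α(X)) + t·exp((α+1)h_α(X + Z)) for
t ∈ [0,1], when 0 < α < 1. -/
theorem renyi_costa_EPI
    (f : ℝ → ℝ) (hfm : Measurable f) (hf0 : ∀ x, 0 ≤ f x)
    (hf1 : (∫ x : ℝ, f x) = 1)
    (α : ℝ) (hαl : 0 < α) (hαu : α < 1)
    (hfin : ∀ s ∈ Set.Icc (0 : ℝ) 1, renyiFinite0 f α s) :
    ∀ t ∈ Set.Icc (0 : ℝ) 1,
      (1 - t) * Real.exp ((α + 1) * renyiEnt0 f α 0)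
          + t * Real.exp ((α + 1) * renyiEnt0 f α 1)
        ≤ Real.exp ((α + 1) * renyiEnt0 f α t) := by
  have hm0 : 0 ≤ (α + 1) / (1 - α) := div_nonneg (by linarith) (by linarith)
  have hpos : 0 < ∫ x, f x := by rw [hf1]; exact one_pos
  have hf : Integrable f := by
    by_contra h
    rw [integral_undef h] at hf1
    exact zero_ne_one hf1
  have hfin0 : Integrable (fun x => f x ^ α) ∧ 0 < ∫ x, f x ^ α := by
    have := hfin 0 ⟨le_rfl, zero_le_one⟩
    simpa [renyiFinite0, hαu.ne, heatP0] using this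
  have hfinp : ∀ s : ℝ, 0 < s → s ≤ 1 → Integrable (fun x => kP f 0 s x ^ α) ∧ 0 < ∫ x, kP f 0 s x ^ α := by
    intro s hs hs1
    have := hfin s ⟨hs.le, hs1⟩
    simpa [renyiFinite0, hαu.ne, heatP0, hs.ne', heatP_eq_kP] using this
  have hN : ∀ a : ℝ, 0 < a →
      Real.exp ((α + 1) * ((1 - α)⁻¹ * Real.log a)) = a ^ ((α + 1) / (1 - α)) := by
    intro a ha
    rw [Real.rpow_def_of_pos ha]; congr 1; ring
  have hN0 : Real.exp ((α + 1) * renyiEnt0 f α 0) = (∫ x, f x ^ α) ^ ((α + 1) / (1 - α)) := by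
    rw [← hN _ hfin0.2]; simp [renyiEnt0, hαu.ne, heatP0]
  have hNs : ∀ s : ℝ, 0 < s → s ≤ 1 → Real.exp ((α + 1) * renyiEnt0 f α s)
      = (∫ x, kP f 0 s x ^ α) ^ ((α + 1) / (1 - α)) := by
    intro s hs hs1
    rw [← hN _ (hfinp s hs hs1).2]; simp [renyiEnt0, hαu.ne, heatP0, hs.ne', heatP_eq_kP]
  intro t ht
  rcases eq_or_lt_of_le ht.1 with h | ht0
  · rw [← h]; simp
  rcases eq_or_lt_of_le ht.2 with h | ht1
  · rw [h]; simp
  rw [hN0, hNs t ht0 ht.2, hNs 1 one_pos le_rfl]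
  have hlim : ∀ s : ℝ, 0 < s → s ≤ 1 → Tendsto (fun n : ℕ =>
      (∫ x, kP ((Set.Icc (-(n : ℝ)) n).indicator f) 0 s x ^ α) ^ ((α + 1) / (1 - α))) atTop
      (nhds ((∫ x, kP f 0 s x ^ α) ^ ((α + 1) / (1 - α)))) := fun s hs hs1 =>
    (kP_tendsto f hf hfm hf0 α hαl s hs (hfinp s hs hs1).1).rpow_const (Or.inr hm0)
  set m := (α + 1) / (1 - α) with hm
  have hconc : ∀ ε : ℝ, 0 < ε → ε < t →
      (1 - t) / (1 - ε) * (∫ x, kP f 0 ε x ^ α) ^ m + (t - ε) / (1 - ε) * (∫ x, kP f 0 1 x ^ α) ^ m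
        ≤ (∫ x, kP f 0 t x ^ α) ^ m := by
    intro ε hε hεt
    have hε1 : 0 < 1 - ε := by linarith
    refine le_of_tendsto_of_tendsto
      (((hlim ε hε (by linarith)).const_mul _).add ((hlim 1 one_pos le_rfl).const_mul _))
      (hlim t ht0 ht.2) ?_
    filter_upwards [trunc_pos f hf hf0 hpos] with n hn
    have := (kP_concave _ (hf.indicator measurableSet_Icc)
      (fun x => Set.indicator_nonneg (fun y _ => hf0 y) x) hn n
      (fun y hy => Set.indicator_of_notMem hy f) α hαl hαu).2 (show ε ∈ Set.Ioi (0 : ℝ) from hε)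
      (show (1 : ℝ) ∈ Set.Ioi (0 : ℝ) from Set.mem_Ioi.2 one_pos)
      (show 0 ≤ (1 - t) / (1 - ε) from div_nonneg (by linarith) hε1.le)
      (show 0 ≤ (t - ε) / (1 - ε) from div_nonneg (by linarith) hε1.le)
      (by field_simp; ring)
    have he : (1 - t) / (1 - ε) * ε + (t - ε) / (1 - ε) * 1 = t := by field_simp; ring
    simp only [smul_eq_mul, he] at this
    exact this
  have hev : ∀ᶠ ε in nhdsWithin (0 : ℝ) (Set.Ioi 0),
      (1 - t) / (1 - ε) * (∫ x, f x ^ α) ^ m + (t - ε) / (1 - ε) * (∫ x, kP f 0 1 x ^ α) ^ m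
        ≤ (∫ x, kP f 0 t x ^ α) ^ m := by
    filter_upwards [Ioo_mem_nhdsGT ht0] with ε hε
    refine le_trans ?_ (hconc ε hε.1 hε.2)
    have h2 : (0:ℝ) ≤ (1 - t) / (1 - ε) := div_nonneg (by linarith) (by linarith [hε.2])
    have h3 := kP_jensen f hf hf0 hpos α hαl hαu ε hε.1 hfin0.1 (hfinp ε hε.1 (by linarith [hε.2])).1
    have h4 := hfin0.2.le
    gcongr
  refine le_of_tendsto ?_ hev
  refine Tendsto.mono_left ?_ nhdsWithin_le_nhds
  have hcont : ContinuousAt (fun ε : ℝ => (1 - t) / (1 - ε) * (∫ x, f x ^ α) ^ m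
      + (t - ε) / (1 - ε) * (∫ x, kP f 0 1 x ^ α) ^ m) 0 := by
    fun_prop (disch := norm_num)
  have := hcont.tendsto
  simpa using this
end
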